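/- arXiv:math/9803042 — 4 statements merged into one kernel-verified Lean document; each statement's English description precedes it below -/
import Mathlib

section
/- Let G be a group of nilpotency class at most 2. Then G is absolutely closed in N₂ if and only if for all x, y ∈ G and every integer n > 0, at least one of the following holds: (2.10) there exist integers a, b, c and elements g₁, g₂ ∈ G such that g₁^n ≡ x^a y^b (mod [G,G]), g₂^n ≡ x^b y^c (mod [G,G]), and [g₁,x][g₂,y] ≠ e; or (2.11) there exist integers a, b, c and elements g₁, g₂ ∈ G such that g₁^n ≡ x^a y^b (mod [G,G]) and g₂^n ≡ x^{b+1} y^c (mod [G,G]). -/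
universe u

/-- A group is nilpotent of class at most 2 (lies in `N₂`) if its commutator
subgroup is contained in its center. -/
def IsNil2 (G : Type*) [Group G] : Prop :=
  commutator G ≤ Subgroup.center G

/-- The dominion of a subgroup `B` of `A` in the variety `N₂`: the set of `a ∈ A`
such that any two homomorphisms from `A` to a nil-2 group agreeing on `B` agree at `a`. -/
def Dominion {A : Type u} [Group A] (B : Subgroup A) : Set A :=
  {a | ∀ (C : Type u) [Group C], IsNil2 C →
    ∀ f g : A →* C, (∀ b ∈ B, f b = g b) → f a = g a}

/-- A group `B` is absolutely closed in `N₂` if for every nil-2 group `A`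
containing (a copy of) `B` as a subgroup, the dominion of `B` in `A` is `B`. -/
def IsAbsolutelyClosed (B : Type u) [Group B] : Prop :=
  ∀ (A : Type u) [Group A], IsNil2 A →
    ∀ ι : B →* A, Function.Injective ι →
      Dominion ι.range = (ι.range : Set A)

/-- Condition (2.10): there exist integers `a`, `b`, `c` and `g₁ g₂ ∈ G` with
`g₁ⁿ ≡ xᵃyᵇ (mod [G,G])`, `g₂ⁿ ≡ xᵇyᶜ (mod [G,G])` and `[g₁,x][g₂,y] ≠ e`. -/
def Cond210 {G : Type*} [Group G] (x y : G) (n : ℕ) : Prop :=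
  ∃ (a b c : ℤ) (g₁ g₂ : G),
    g₁ ^ n * (x ^ a * y ^ b)⁻¹ ∈ commutator G ∧
    g₂ ^ n * (x ^ b * y ^ c)⁻¹ ∈ commutator G ∧
    g₁⁻¹ * x⁻¹ * g₁ * x * (g₂⁻¹ * y⁻¹ * g₂ * y) ≠ 1

/-- Condition (2.11): there exist integers `a`, `b`, `c` and `g₁ g₂ ∈ G` with
`g₁ⁿ ≡ xᵃyᵇ (mod [G,G])` and `g₂ⁿ ≡ x^{b+1}yᶜ (mod [G,G])`. -/
def Cond211 {G : Type*} [Group G] (x y : G) (n : ℕ) : Prop :=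
  ∃ (a b c : ℤ) (g₁ g₂ : G),
    g₁ ^ n * (x ^ a * y ^ b)⁻¹ ∈ commutator G ∧
    g₂ ^ n * (x ^ (b + 1) * y ^ c)⁻¹ ∈ commutator G


namespace Nil2Aux

open scoped commutatorElement



instance centerCommGroup (A : Type*) [Group A] : CommGroup (Subgroup.center A) :=
  { (inferInstance : Group (Subgroup.center A)) with
    mul_comm := fun a b => Subtype.ext (Subgroup.mem_center_iff.1 b.2 a) }

theorem nil2_of_forall {A : Type*} [Group A] (h : ∀ a b c : A, ⁅a, b⁆ * c = c * ⁅a, b⁆) : IsNil2 A := by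
  unfold IsNil2
  rw [commutator_def, Subgroup.commutator_le]
  intro a _ b _
  rw [Subgroup.mem_center_iff]
  intro c
  exact (h a b c).symm

/-- The commutator `a⁻¹ b⁻¹ a b`. -/
def cm {A : Type*} [Group A] (a b : A) : A := a⁻¹ * b⁻¹ * a * b

theorem cm_mem {A : Type*} [Group A] (a b : A) : cm a b ∈ commutator A := by
  have : cm a b = ⁅a⁻¹, b⁻¹⁆ := by simp [cm, commutatorElement_def]
  rw [this]
  exact Subgroup.commutator_mem_commutator (Subgroup.mem_top _) (Subgroup.mem_top _)

theorem mul_cm {A : Type*} [Group A] (a b : A) : b * a * cm a b = a * b := by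
  simp [cm, mul_assoc]

theorem cm_comm {A : Type*} [Group A] (hA : IsNil2 A) (a b c : A) : cm a b * c = c * cm a b :=
  ((Subgroup.mem_center_iff.1 (hA (cm_mem a b))) c).symm

theorem nil2_of_cm {A : Type*} [Group A] (h : ∀ a b c : A, cm a b * c = c * cm a b) : IsNil2 A := by
  apply nil2_of_forall
  intro a b c
  have : ⁅a, b⁆ = cm a⁻¹ b⁻¹ := by simp [cm, commutatorElement_def]
  rw [this, h]

/-- Commutator as a bimultiplicative map into the center. -/
def bil {A : Type*} [Group A] (hA : IsNil2 A) : A →* A →* Subgroup.center A :=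
  MonoidHom.mk' (fun a => MonoidHom.mk' (fun b => ⟨cm a b, hA (cm_mem a b)⟩) (by
    intro b c
    ext
    show cm a (b * c) = cm a b * cm a c
    have h1 : a * (b * c) = b * c * a * (cm a b * cm a c) := by
      rw [← mul_assoc a b c, ← mul_cm a b, mul_assoc (b * a), cm_comm hA a b c,
        ← mul_assoc, mul_assoc b a c, ← mul_cm a c, cm_comm hA a b]
      simp only [mul_assoc]
    rw [← mul_cm a (b * c)] at h1
    exact mul_left_cancel h1)) (by
    intro a b
    ext c
    show cm (a * b) c = cm a c * cm b c
    have h1 : a * b * c = c * (a * b) * (cm a c * cm b c) := by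
      rw [mul_assoc a b c, ← mul_cm b c, ← mul_assoc a, ← mul_assoc a c b, ← mul_cm a c,
        mul_assoc (c * a), cm_comm hA a c b]
      simp only [mul_assoc]
    rw [← mul_cm (a * b) c] at h1
    exact mul_left_cancel h1)

theorem bil_coe {A : Type*} [Group A] (hA : IsNil2 A) (a b : A) :
    (bil hA a b : A) = cm a b := rfl

theorem bil_self {A : Type*} [Group A] (hA : IsNil2 A) (a : A) : bil hA a a = 1 := by
  ext; simp [bil_coe, cm]

theorem bil_symm {A : Type*} [Group A] (hA : IsNil2 A) (a b : A) :
    bil hA a b = (bil hA b a)⁻¹ := by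
  ext; simp [bil_coe, cm, mul_assoc]

theorem hom_commutator {A T : Type*} [Group A] [CommGroup T] (f : A →* T) {c : A}
    (hc : c ∈ commutator A) : f c = 1 := by
  have : commutator A ≤ f.ker := Abelianization.commutator_subset_ker f
  exact this hc

theorem hom2_commutator_right {A T : Type*} [Group A] [CommGroup T] (f : A →* A →* T) {c : A}
    (hc : c ∈ commutator A) (a : A) : f a c = 1 := hom_commutator _ hc

theorem hom2_commutator_left {A T : Type*} [Group A] [CommGroup T] (f : A →* A →* T) {c : A}
    (hc : c ∈ commutator A) (a : A) : f c a = 1 := by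
  rw [hom_commutator f hc]; rfl

theorem map_cm {A C : Type*} [Group A] [Group C] (f : A →* C) (a b : A) :
    f (cm a b) = cm (f a) (f b) := by simp [cm]

theorem nil2_surj {A C : Type*} [Group A] [Group C] (hA : IsNil2 A) (f : A →* C)
    (hf : Function.Surjective f) : IsNil2 C := by
  apply nil2_of_cm
  intro a b c
  obtain ⟨a, rfl⟩ := hf a
  obtain ⟨b, rfl⟩ := hf b
  obtain ⟨c, rfl⟩ := hf c
  rw [← map_cm, ← map_mul, ← map_mul, cm_comm hA]

/-- Central extension by a bimultiplicative cocycle. -/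
@[ext] structure CExt {A T : Type*} [Group A] [CommGroup T] (β : A →* A →* T) where
  a : A
  t : T

namespace CExt
variable {A T : Type*} [Group A] [CommGroup T] {β : A →* A →* T}

instance : Mul (CExt β) := ⟨fun p q => ⟨p.a * q.a, p.t * q.t * β p.a q.a⟩⟩
instance : One (CExt β) := ⟨⟨1, 1⟩⟩
instance : Inv (CExt β) := ⟨fun p => ⟨p.a⁻¹, p.t⁻¹ * β p.a p.a⟩⟩

@[simp] theorem mul_a (p q : CExt β) : (p * q).a = p.a * q.a := rfl
@[simp] theorem mul_t (p q : CExt β) : (p * q).t = p.t * q.t * β p.a q.a := rfl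
@[simp] theorem one_a : (1 : CExt β).a = 1 := rfl
@[simp] theorem one_t : (1 : CExt β).t = 1 := rfl
@[simp] theorem inv_a (p : CExt β) : (p⁻¹).a = p.a⁻¹ := rfl
@[simp] theorem inv_t (p : CExt β) : (p⁻¹).t = p.t⁻¹ * β p.a p.a := rfl

instance : Group (CExt β) := Group.ofLeftAxioms
  (by
    intro p q r
    ext
    · simp [mul_assoc]
    · simp only [mul_t, mul_a, map_mul, MonoidHom.mul_apply]
      simp only [mul_assoc, mul_comm, mul_left_comm])
  (by intro p; ext <;> simp)
  (by
    intro p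
    ext
    · simp
    · simp)

/-- projection -/
def fst : CExt β →* A := MonoidHom.mk' CExt.a (fun _ _ => rfl)

theorem cm_eq (p q : CExt β) : cm p q = ⟨cm p.a q.a, β p.a q.a * (β q.a p.a)⁻¹⟩ := by
  have h := mul_cm p q
  have h2 : q * p * (⟨cm p.a q.a, β p.a q.a * (β q.a p.a)⁻¹⟩ : CExt β) = p * q := by
    ext
    · simp [mul_cm]
    · simp only [mul_t, mul_a, hom2_commutator_right β (cm_mem _ _)]
      simp only [mul_assoc, mul_comm, mul_left_comm]
      simp
  rw [← h] at h2
  exact (mul_left_cancel h2).symm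

theorem nil2 (hA : IsNil2 A) : IsNil2 (CExt β) := by
  apply nil2_of_cm
  intro p q r
  rw [cm_eq]
  ext
  · simp [cm_comm hA]
  · simp only [mul_t, hom2_commutator_right β (cm_mem _ _), hom2_commutator_left β (cm_mem _ _)]
    rw [mul_comm r.t]

end CExt

theorem nc_form {P : Type*} [Group P] (hP : IsNil2 P) (α β : P) {z : P}
    (hz : z ∈ Subgroup.normalClosure ({α, β} : Set P)) :
    ∃ (k l : ℤ) (p q : P), z = α ^ k * β ^ l * (cm α p * cm β q) := by
  have key : ∀ (k l k' l' : ℤ) (m m' : Subgroup.center P),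
      (α ^ k * β ^ l * m) * (α ^ k' * β ^ l' * m') =
        α ^ (k + k') * β ^ (l + l') * (bil hP β (α ^ (l * k')) * m * m' : Subgroup.center P) := by
    intro k l k' l' m m'
    have hm : ∀ w : P, (m : P) * w = w * m := fun w => (Subgroup.mem_center_iff.1 m.2 w).symm
    have e1 : β ^ l * α ^ k' = α ^ k' * β ^ l * (bil hP β (α ^ (l * k')) : P) := by
      have : bil hP β (α ^ (l * k')) = bil hP (β ^ l) (α ^ k') := by
        rw [map_zpow, map_zpow, map_zpow, MonoidHom.zpow_apply, ← zpow_mul]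
      rw [this, bil_coe, mul_cm]
    have hb : ∀ w : P, (bil hP β (α ^ (l * k')) : P) * w = w * bil hP β (α ^ (l * k')) :=
      fun w => (Subgroup.mem_center_iff.1 (bil hP β (α ^ (l * k'))).2 w).symm
    calc (α ^ k * β ^ l * m) * (α ^ k' * β ^ l' * m')
        = α ^ k * (β ^ l * α ^ k') * β ^ l' * m * m' := by
          rw [mul_assoc _ (m : P), ← mul_assoc (m : P), hm]
          simp only [mul_assoc]
      _ = α ^ k * α ^ k' * (β ^ l * β ^ l') * (bil hP β (α ^ (l * k')) * m * m') := by
          rw [e1]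
          simp only [mul_assoc]
          rw [← mul_assoc (bil hP β (α ^ (l * k')) : P) (β ^ l'), hb]
          simp only [mul_assoc]
      _ = _ := by
          rw [zpow_add, zpow_add]; rfl
  suffices h : ∃ (k l : ℤ) (p q : P),
      z = α ^ k * β ^ l * (bil hP α p * bil hP β q : Subgroup.center P) from h
  unfold Subgroup.normalClosure at hz
  induction hz using Subgroup.closure_induction with
  | mem w hw =>
    rw [Group.mem_conjugatesOfSet_iff] at hw
    obtain ⟨a, ha, hw⟩ := hw
    rw [isConj_iff] at hw
    obtain ⟨c, hc⟩ := hw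
    have hc' : w = a * cm a c⁻¹ := by rw [← hc]; simp [cm, mul_assoc]
    rcases ha with rfl | ha
    · refine ⟨1, 0, c⁻¹, 1, ?_⟩
      rw [hc', show cm a c⁻¹ = (bil hP a c⁻¹ : P) from rfl]; simp
    · rw [Set.mem_singleton_iff] at ha
      subst ha
      refine ⟨0, 1, 1, c⁻¹, ?_⟩
      rw [hc', show cm a c⁻¹ = (bil hP a c⁻¹ : P) from rfl]; simp
  | one => exact ⟨0, 0, 1, 1, by simp⟩
  | mul w w' _ _ h h' =>
    obtain ⟨k, l, p, q, rfl⟩ := h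
    obtain ⟨k', l', p', q', rfl⟩ := h'
    refine ⟨k + k', l + l', p * p', q * q' * α ^ (l * k'), ?_⟩
    rw [key]
    congr 2
    simp only [map_mul, mul_assoc, mul_comm, mul_left_comm]
  | inv w _ h =>
    obtain ⟨k, l, p, q, rfl⟩ := h
    refine ⟨-k, -l, p⁻¹, q⁻¹ * α ^ (- (l * (-k))), ?_⟩
    rw [inv_eq_iff_mul_eq_one, key]
    have aux : ∀ x y w : Subgroup.center P, w * (x * y) * (x⁻¹ * (y⁻¹ * w⁻¹)) = 1 := by
      intro x y w
      rw [show w * (x * y) * (x⁻¹ * (y⁻¹ * w⁻¹)) = (x * x⁻¹) * (y * y⁻¹) * (w * w⁻¹) by ac_rfl]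
      simp
    simp only [map_mul, map_inv, zpow_neg α (l * -k), add_neg_cancel, zpow_zero, one_mul, aux]
    rfl

end Nil2Aux

namespace Nil2Aux

theorem cm_pow_mem_dominion {A : Type u} [Group A] (B : Subgroup A) (r s : A) (n : ℕ)
    (hr : r ^ n ∈ B) (hs : s ^ n ∈ B) : cm r s ^ n ∈ Dominion B := by
  intro C _ hC f g hfg
  have h1 : f (r ^ n) = g (r ^ n) := hfg _ hr
  have h2 : f (s ^ n) = g (s ^ n) := hfg _ hs
  have key : bil hC (f r) (f s) ^ n = bil hC (g r) (g s) ^ n := by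
    calc bil hC (f r) (f s) ^ n = bil hC (f (r ^ n)) (f s) := by simp
      _ = bil hC (g r) (f (s ^ n)) := by rw [h1]; simp
      _ = bil hC (g r) (g s) ^ n := by rw [h2]; simp
  have := congrArg (Subtype.val) key
  simpa [bil_coe, map_cm] using this

theorem nil2_prod {A C : Type*} [Group A] [Group C] (hA : IsNil2 A) (hC : IsNil2 C) :
    IsNil2 (A × C) := by
  apply nil2_of_cm
  rintro ⟨a, a'⟩ ⟨b, b'⟩ ⟨c, c'⟩
  exact Prod.ext (cm_comm hA a b c) (cm_comm hC a' b' c')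

theorem nil2_comm {A : Type*} [CommGroup A] : IsNil2 A := by
  apply nil2_of_cm
  intro a b c
  exact mul_comm _ _

section big
variable (G : Type u) [Group G]

abbrev A1 := G × Multiplicative ℤ × Multiplicative ℤ
abbrev T1 := Abelianization G × Abelianization G × Multiplicative ℤ

def bigβ : A1 G →* A1 G →* T1 G :=
  MonoidHom.mk' (fun p => MonoidHom.mk' (fun q =>
    ((Abelianization.of q.1) ^ (Multiplicative.toAdd p.2.1),
     (Abelianization.of q.1) ^ (Multiplicative.toAdd p.2.2),
     Multiplicative.ofAdd (Multiplicative.toAdd p.2.2 * Multiplicative.toAdd q.2.1)))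
    (by
      intro q q'
      simp [mul_zpow, mul_add])) (by
    intro p p'
    ext q <;> simp [zpow_add, add_mul])

theorem bigβ_apply (p q : A1 G) : bigβ G p q =
    ((Abelianization.of q.1) ^ (Multiplicative.toAdd p.2.1),
     (Abelianization.of q.1) ^ (Multiplicative.toAdd p.2.2),
     Multiplicative.ofAdd (Multiplicative.toAdd p.2.2 * Multiplicative.toAdd q.2.1)) := rfl

abbrev Big := CExt (bigβ G)

def inG : G →* Big G := MonoidHom.mk' (fun g => ⟨(g, 1, 1), 1⟩) (by
  intro g h
  ext <;> simp [bigβ_apply])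

variable {G}

theorem e1_pow (n : ℕ) : (⟨(1, Multiplicative.ofAdd 1, 1), 1⟩ : Big G) ^ n =
    ⟨(1, Multiplicative.ofAdd (n : ℤ), 1), 1⟩ := by
  induction n with
  | zero => rfl
  | succ n ih => rw [pow_succ, ih]; ext <;> simp [bigβ_apply]

theorem e2_pow (n : ℕ) : (⟨(1, 1, Multiplicative.ofAdd 1), 1⟩ : Big G) ^ n =
    ⟨(1, 1, Multiplicative.ofAdd (n : ℤ)), 1⟩ := by
  induction n with
  | zero => rfl
  | succ n ih => rw [pow_succ, ih]; ext <;> simp [bigβ_apply]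

theorem e21_pow (n : ℕ) : (cm ⟨(1, 1, Multiplicative.ofAdd 1), 1⟩
    ⟨(1, Multiplicative.ofAdd 1, 1), 1⟩ : Big G) ^ n =
    ⟨1, (1, 1, Multiplicative.ofAdd (n : ℤ))⟩ := by
  have : (cm ⟨(1, 1, Multiplicative.ofAdd 1), 1⟩
    ⟨(1, Multiplicative.ofAdd 1, 1), 1⟩ : Big G) = ⟨1, (1, 1, Multiplicative.ofAdd 1)⟩ := by
    rw [CExt.cm_eq]; ext <;> simp [bigβ_apply, cm]
  rw [this]
  induction n with
  | zero => rfl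
  | succ n ih => rw [pow_succ, ih]; ext <;> simp [bigβ_apply]

theorem big_extract (hG : IsNil2 G) (x y : G) (n : ℕ) (hn : 0 < n) (z : Big G)
    (hz : z ∈ Subgroup.normalClosure ({⟨(x⁻¹, Multiplicative.ofAdd (n : ℤ), 1), 1⟩,
      ⟨(y⁻¹, 1, Multiplicative.ofAdd (n : ℤ)), 1⟩} : Set (Big G))) (hz2 : z.a.2 = 1) :
    ∃ (g h : G) (i j i' j' : ℤ), z = ⟨(cm x⁻¹ g * cm y⁻¹ h, 1, 1),
      (Abelianization.of g ^ n * (Abelianization.of x ^ i * Abelianization.of y ^ i'),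
       Abelianization.of h ^ n * (Abelianization.of x ^ j * Abelianization.of y ^ j'),
       Multiplicative.ofAdd (n * (i' - j)))⟩ := by
  obtain ⟨k, l, p, q, h⟩ := nc_form (CExt.nil2 (nil2_prod hG nil2_comm)) _ _ hz
  have hfst := congrArg (fun w => (CExt.fst w).2) h
  simp only [map_mul, map_cm, map_zpow, Prod.snd_mul, Prod.pow_snd] at hfst
  change z.a.2 = _ at hfst
  rw [hz2] at hfst
  have h1 := congrArg (fun w => Multiplicative.toAdd w.1) hfst
  have h2 := congrArg (fun w => Multiplicative.toAdd w.2) hfst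
  have hk : k = 0 := by
    simp [CExt.fst, cm] at h1
    omega
  have hl : l = 0 := by
    simp [CExt.fst, cm] at h2
    omega
  subst hk hl
  rw [zpow_zero, zpow_zero, one_mul, one_mul, CExt.cm_eq, CExt.cm_eq] at h
  refine ⟨p.a.1, q.a.1, Multiplicative.toAdd p.a.2.1, Multiplicative.toAdd p.a.2.2,
    Multiplicative.toAdd q.a.2.1, Multiplicative.toAdd q.a.2.2, ?_⟩
  rw [h]
  ext
  · simp [cm]
  · simp [cm]
  · simp [cm]
  · simp [bigβ_apply, cm, mul_assoc]
  · simp [bigβ_apply, cm, mul_assoc]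
    rw [mul_left_comm]
  · simp [bigβ_apply, cm]
    ring

theorem mem_comm_iff (a b : G) : a * b⁻¹ ∈ commutator G ↔
    Abelianization.of a = Abelianization.of b := by
  rw [← Abelianization.ker_of, MonoidHom.mem_ker, map_mul, map_inv, mul_inv_eq_one]

theorem not_closed (hG : IsNil2 G) (x y : G) (n : ℕ) (hn : 0 < n) (h0 : ¬ Cond210 x y n)
    (h1 : ¬ Cond211 x y n) : ¬ IsAbsolutelyClosed G := by
  intro hcl
  let al : Big G := ⟨(x⁻¹, Multiplicative.ofAdd (n : ℤ), 1), 1⟩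
  let be : Big G := ⟨(y⁻¹, 1, Multiplicative.ofAdd (n : ℤ)), 1⟩
  let N : Subgroup (Big G) := Subgroup.normalClosure {al, be}
  have hal : al ∈ N := Subgroup.subset_normalClosure (by simp)
  have hbe : be ∈ N := Subgroup.subset_normalClosure (by simp)
  let e1 : Big G := ⟨(1, Multiplicative.ofAdd 1, 1), 1⟩
  let e2 : Big G := ⟨(1, 1, Multiplicative.ofAdd 1), 1⟩
  have hBig : IsNil2 (Big G) := CExt.nil2 (nil2_prod hG nil2_comm)
  have hQ : IsNil2 (Big G ⧸ N) := nil2_surj hBig (QuotientGroup.mk' N) (QuotientGroup.mk'_surjective N)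
  let io : G →* Big G ⧸ N := (QuotientGroup.mk' N).comp (inG G)
  have hz1 : inG G x * al = e1 ^ n := by
    rw [e1_pow]; ext <;> simp [inG, al, bigβ_apply]
  have hz2 : inG G y * be = e2 ^ n := by
    rw [e2_pow]; ext <;> simp [inG, be, bigβ_apply]
  have hinj : Function.Injective io := by
    rw [injective_iff_map_eq_one]
    intro g hg
    have hgN : inG G g ∈ N := (QuotientGroup.eq_one_iff _).1 hg
    obtain ⟨g1, g2, i, j, i', j', h⟩ := big_extract hG x y n hn _ hgN rfl
    have ha := congrArg (fun w => w.a.1) h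
    have hu := congrArg (fun w => w.t.1) h
    have hv := congrArg (fun w => w.t.2.1) h
    have hk := congrArg (fun w => Multiplicative.toAdd w.t.2.2) h
    simp [inG] at ha hu hv hk
    have hij : i' = j := by omega
    subst hij
    by_contra hne
    apply h0
    refine ⟨-i, -i', -j', g1, g2, ?_, ?_, ?_⟩
    · rw [mem_comm_iff]
      simp only [map_pow, map_mul, map_zpow]
      simp only [zpow_neg, ← mul_inv]
      exact eq_inv_of_mul_eq_one_left hu.symm
    · rw [mem_comm_iff]
      simp only [map_pow, map_mul, map_zpow]
      simp only [zpow_neg, ← mul_inv]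
      exact eq_inv_of_mul_eq_one_left hv.symm
    · have e : g = cm g1 x * cm g2 y := by
        rw [ha]
        change ((bil hG x⁻¹ g1 * bil hG y⁻¹ g2 : Subgroup.center G) : G) =
          (bil hG g1 x * bil hG g2 y : Subgroup.center G)
        rw [bil_symm hG g1 x, bil_symm hG g2 y, map_inv, map_inv]; rfl
      change cm g1 x * cm g2 y ≠ 1
      rwa [← e]
  have hr : (QuotientGroup.mk' N e1) ^ n ∈ io.range := by
    refine ⟨x, ?_⟩
    rw [← map_pow, ← hz1, map_mul]
    have : QuotientGroup.mk' N al = 1 := (QuotientGroup.eq_one_iff _).2 hal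
    rw [this, mul_one]; rfl
  have hs : (QuotientGroup.mk' N e2) ^ n ∈ io.range := by
    refine ⟨y, ?_⟩
    rw [← map_pow, ← hz2, map_mul]
    have : QuotientGroup.mk' N be = 1 := (QuotientGroup.eq_one_iff _).2 hbe
    rw [this, mul_one]; rfl
  have hdom := cm_pow_mem_dominion io.range _ _ n hs hr
  rw [hcl _ hQ io hinj] at hdom
  obtain ⟨g0, hg0⟩ := hdom
  rw [← map_cm, ← map_pow] at hg0
  have hmem : (inG G g0)⁻¹ * cm e2 e1 ^ n ∈ N := QuotientGroup.eq.1 hg0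
  rw [e21_pow] at hmem
  obtain ⟨g1, g2, i, j, i', j', h⟩ := big_extract hG x y n hn _ hmem rfl
  have hu := congrArg (fun w => w.t.1) h
  have hv := congrArg (fun w => w.t.2.1) h
  have hk := congrArg (fun w => Multiplicative.toAdd w.t.2.2) h
  simp [inG, bigβ_apply] at hu hv hk
  have hij : j = i' - 1 := by
    have hn' : (n : ℤ) ≠ 0 := by omega
    have : (n : ℤ) * (i' - j) = n * 1 := by linarith
    have := mul_left_cancel₀ hn' this
    omega
  subst hij
  apply h1
  refine ⟨-i, -i', -j', g1, g2, ?_, ?_⟩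
  · rw [mem_comm_iff]
    simp only [map_pow, map_mul, map_zpow]
    simp only [zpow_neg, ← mul_inv]
    exact eq_inv_of_mul_eq_one_left hu.symm
  · rw [mem_comm_iff, show -i' + 1 = -(i' - 1) by ring]
    simp only [map_pow, map_mul, map_zpow]
    simp only [zpow_neg, ← mul_inv]
    exact eq_inv_of_mul_eq_one_left hv.symm

end big

end Nil2Aux

namespace Nil2Aux

theorem pair_split {T : Type*} [AddCommGroup T] (d e : ℤ) (w : T)
    (h : (Int.lcm d e) • w = 0) : ∃ α β : T, e • α = 0 ∧ d • β = 0 ∧ α - β = w := by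
  by_cases hg : (Int.gcd d e : ℤ) = 0
  · have hg' : Int.gcd d e = 0 := by exact_mod_cast hg
    rw [Int.gcd_eq_zero_iff] at hg'
    obtain ⟨rfl, rfl⟩ := hg'
    exact ⟨w, 0, by simp, by simp, by simp⟩
  · obtain ⟨d', hd⟩ := Int.gcd_dvd_left d e
    obtain ⟨e', he⟩ := Int.gcd_dvd_right d e
    have hb := Int.gcd_eq_gcd_ab d e
    set g : ℤ := (Int.gcd d e : ℤ) with hgdef
    have h1 : d' * Int.gcdA d e + e' * Int.gcdB d e = 1 := by
      apply mul_left_cancel₀ hg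
      calc g * (d' * Int.gcdA d e + e' * Int.gcdB d e)
          = (g * d') * Int.gcdA d e + (g * e') * Int.gcdB d e := by ring
        _ = g * 1 := by rw [← hd, ← he, ← hb, mul_one]
    have hl : (g * d' * e') • w = 0 := by
      have h2 : ((Int.lcm d e : ℕ) : ℤ) • w = 0 := by rw [natCast_zsmul]; exact h
      have h3 : ((Int.lcm d e : ℕ) : ℤ) ∣ g * d' * e' := by
        apply Int.coe_lcm_dvd
        · exact ⟨e', by rw [← hd]⟩
        · exact ⟨d', by rw [mul_right_comm, ← he]⟩
      obtain ⟨m, hm⟩ := h3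
      rw [hm, mul_comm, mul_smul, h2, smul_zero]
    refine ⟨(d' * Int.gcdA d e) • w, (-(e' * Int.gcdB d e)) • w, ?_, ?_, ?_⟩
    · rw [smul_smul, show e * (d' * Int.gcdA d e) = Int.gcdA d e * (g * d' * e') by
        rw [he]; ring, mul_smul, hl, smul_zero]
    · rw [smul_smul, show d * (-(e' * Int.gcdB d e)) = -Int.gcdB d e * (g * d' * e') by
        rw [hd]; ring, mul_smul, hl, smul_zero]
    · rw [neg_smul, sub_neg_eq_add, ← add_smul, h1, one_smul]

theorem snf_exists {k : ℕ} (N : Submodule ℤ (Fin k → ℤ)) :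
    ∃ (b : Module.Basis (Fin k) ℤ (Fin k → ℤ)) (d : Fin k → ℤ),
      (∀ i, d i • b i ∈ N) ∧ ∀ y ∈ N, ∀ i, d i ∣ b.repr y i := by
  classical
  obtain ⟨m, s⟩ := Submodule.smithNormalForm (Pi.basisFun ℤ (Fin k)) N
  refine ⟨s.bM, fun i => if h : ∃ j, s.f j = i then s.a h.choose else 0, ?_, ?_⟩
  · intro i
    by_cases h : ∃ j, s.f j = i
    · simp only [h, dif_pos]
      have := s.snf h.choose
      rw [h.choose_spec] at this
      rw [← this]
      exact (s.bN _).2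
    · simp only [h, dif_neg, not_false_eq_true]
      simp
  · intro y hy i
    by_cases h : ∃ j, s.f j = i
    · simp only [h, dif_pos]
      have := s.repr_apply_embedding_eq_repr_smul ⟨y, hy⟩ (i := h.choose)
      rw [h.choose_spec] at this
      simp only at this
      rw [this, map_smul]
      exact ⟨_, by rw [Finsupp.smul_apply, smul_eq_mul]⟩
    · simp only [h, dif_neg, not_false_eq_true]
      have := s.repr_eq_zero_of_notMem_range ⟨y, hy⟩ (i := i) (by simpa using h)
      simp only at this
      rw [this]

theorem fin_theta {V T : Type*} [AddCommGroup V] [AddCommGroup T] (B : AddSubgroup V)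
    (ω : V →+ V →+ T) (hω : ∀ v, ω v v = 0)
    (hB : ∀ (n : ℕ) (r s : V), 0 < n → n • r ∈ B → n • s ∈ B → n • ω r s = 0)
    {k : ℕ} (π : (Fin k → ℤ) →+ V) :
    ∃ θ : (Fin k → ℤ) →ₗ[ℤ] (Fin k → ℤ) →ₗ[ℤ] T,
      (∀ x y, π y ∈ B → θ x y = 0) ∧ ∀ x y, θ x y - θ y x = ω (π x) (π y) := by
  classical
  obtain ⟨b, d, hd1, hd2⟩ := snf_exists (AddSubgroup.toIntSubmodule (B.comap π))
  have hd1' : ∀ i, d i • π (b i) ∈ B := by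
    intro i
    have := hd1 i
    change π (d i • b i) ∈ B at this
    rwa [map_zsmul] at this
  have hanti : ∀ v w, ω v w = - ω w v := by
    intro v w
    have := hω (v + w)
    simp only [map_add, AddMonoidHom.add_apply, hω, zero_add, add_zero] at this
    exact eq_neg_of_add_eq_zero_right this
  have hsplit : ∀ i j, ∃ α β : T, d j • α = 0 ∧ d i • β = 0 ∧ α - β = ω (π (b i)) (π (b j)) := by
    intro i j
    apply pair_split
    rcases Nat.eq_zero_or_pos (Int.lcm (d i) (d j)) with h | h
    · rw [h, zero_smul]
    · apply hB _ _ _ h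
      · obtain ⟨m, hm⟩ := Int.dvd_lcm_left (d i) (d j)
        rw [← natCast_zsmul, hm, mul_comm, mul_smul]
        exact B.zsmul_mem (hd1' i) m
      · obtain ⟨m, hm⟩ := Int.dvd_lcm_right (d i) (d j)
        rw [← natCast_zsmul, hm, mul_comm, mul_smul]
        exact B.zsmul_mem (hd1' j) m
  choose α β h1 h2 h3 using hsplit
  let τ : Fin k → Fin k → T := fun i j => if i < j then α i j else if j < i then β j i else 0
  have hτ1 : ∀ i j, d j • τ i j = 0 := by
    intro i j
    simp only [τ]
    split_ifs
    · exact h1 _ _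
    · exact h2 _ _
    · simp
  have hτ2 : ∀ i j, τ i j - τ j i = ω (π (b i)) (π (b j)) := by
    intro i j
    rcases lt_trichotomy i j with h | h | h
    · simp only [τ, h, if_true, not_lt_of_gt h, if_false]
      exact h3 i j
    · subst h
      simp [hω]
    · simp only [τ, h, if_true, not_lt_of_gt h, if_false]
      rw [hanti, ← h3 j i, neg_sub]
  let θ : (Fin k → ℤ) →ₗ[ℤ] (Fin k → ℤ) →ₗ[ℤ] T :=
    b.constr ℤ (fun i => b.constr ℤ (fun j => τ i j))
  have hθ : ∀ i j, θ (b i) (b j) = τ i j := by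
    intro i j
    simp [θ]
  refine ⟨θ, ?_, ?_⟩
  · intro x y hy
    have hy' : y ∈ AddSubgroup.toIntSubmodule (B.comap π) := hy
    have hz : ∀ i, θ (b i) y = 0 := by
      intro i
      rw [← b.sum_repr y, map_sum]
      apply Finset.sum_eq_zero
      intro j _
      rw [map_smul, hθ]
      obtain ⟨m, hm⟩ := hd2 y hy' j
      rw [hm, mul_comm, mul_smul, hτ1, smul_zero]
    rw [← b.sum_repr x, map_sum, LinearMap.sum_apply]
    apply Finset.sum_eq_zero
    intro i _
    rw [map_smul, LinearMap.smul_apply, hz, smul_zero]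
  · let Ω : (Fin k → ℤ) →ₗ[ℤ] (Fin k → ℤ) →ₗ[ℤ] T :=
      b.constr ℤ (fun i => ((ω (π (b i))).comp π).toIntLinearMap)
    have hΩ : ∀ x y, Ω x y = ω (π x) (π y) := by
      intro x y
      have e : Ω.flip y = ((ω.flip (π y)).comp π).toIntLinearMap := by
        apply b.ext
        intro i
        simp [Ω]
      exact congrArg (fun f => f x) e
    have e : θ - θ.flip = Ω := by
      apply b.ext
      intro i
      apply b.ext
      intro j
      rw [hΩ, ← hτ2, LinearMap.sub_apply, LinearMap.sub_apply, LinearMap.flip_apply, hθ, hθ]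
    intro x y
    rw [← hΩ, ← e]
    rfl

theorem exists_theta {V T : Type*} [AddCommGroup V] [AddCommGroup T] [TopologicalSpace T]
    [IsTopologicalAddGroup T] [T2Space T] [CompactSpace T] (B : AddSubgroup V)
    (ω : V →+ V →+ T) (hω : ∀ v, ω v v = 0)
    (hB : ∀ (n : ℕ) (r s : V), 0 < n → n • r ∈ B → n • s ∈ B → n • ω r s = 0) :
    ∃ θ : V →+ V →+ T, (∀ x, ∀ y ∈ B, θ x y = 0) ∧ ∀ x y, θ x y - θ y x = ω x y := by
  classical
  let K : Finset V → Set (V → V → T) := fun S =>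
    {θ | ∀ a ∈ AddSubgroup.closure (S : Set V), ∀ b ∈ AddSubgroup.closure (S : Set V),
      ∀ c ∈ AddSubgroup.closure (S : Set V),
      θ (a + b) c = θ a c + θ b c ∧ θ c (a + b) = θ c a + θ c b ∧ (b ∈ B → θ a b = 0) ∧
      θ a b - θ b a = ω a b}
  have hcl : ∀ S, IsClosed (K S) := by
    intro S
    simp only [K, Set.ofPred_forall]
    refine isClosed_iInter fun a => isClosed_iInter fun _ => isClosed_iInter fun b =>
      isClosed_iInter fun _ => isClosed_iInter fun c => isClosed_iInter fun _ => ?_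
    simp only [Set.setOf_and, Set.ofPred_forall]
    refine IsClosed.inter (isClosed_eq (by fun_prop) (by fun_prop)) (IsClosed.inter
      (isClosed_eq (by fun_prop) (by fun_prop)) (IsClosed.inter (isClosed_iInter fun _ =>
      isClosed_eq (by fun_prop) (by fun_prop)) (isClosed_eq (by fun_prop) (by fun_prop))))
  have hanti : ∀ S S', S ⊆ S' → K S' ⊆ K S := by
    intro S S' h θ hθ a ha b hb c hc
    have hm := AddSubgroup.closure_mono (show (S : Set V) ⊆ S' from by exact_mod_cast h)
    exact hθ a (hm ha) b (hm hb) c (hm hc)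
  have hne : ∀ S, (K S).Nonempty := by
    intro S
    let e := S.equivFin
    let π : (Fin S.card → ℤ) →+ V :=
      (Fintype.linearCombination ℤ (fun i => ((e.symm i : S) : V))).toAddMonoidHom
    have hπ : ∀ a ∈ AddSubgroup.closure (S : Set V), ∃ x, π x = a := by
      intro a ha
      have : AddSubgroup.closure (S : Set V) ≤ π.range := by
        rw [AddSubgroup.closure_le]
        intro s hs
        refine ⟨Pi.single (e ⟨s, hs⟩) 1, ?_⟩
        simp [π]
      exact this ha
    obtain ⟨θ, h1, h2⟩ := fin_theta B ω hω hB π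
    have hker2 : ∀ x y, π y = 0 → θ x y = 0 := fun x y h => h1 x y (by rw [h]; exact B.zero_mem)
    have hker1 : ∀ x y, π x = 0 → θ x y = 0 := by
      intro x y h
      have := h2 x y
      rw [hker2 y x h, h] at this
      simpa using this
    have hwd : ∀ x x' y y', π x = π x' → π y = π y' → θ x y = θ x' y' := by
      intro x x' y y' hx hy
      have e1 : θ (x - x') y = 0 := hker1 _ _ (by rw [map_sub, hx, sub_self])
      have e2 : θ x' (y - y') = 0 := hker2 _ _ (by rw [map_sub, hy, sub_self])
      rw [map_sub, LinearMap.sub_apply, sub_eq_zero] at e1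
      rw [map_sub, sub_eq_zero] at e2
      rw [e1, e2]
    let σ : V → (Fin S.card → ℤ) := fun v => if h : ∃ x, π x = v then h.choose else 0
    have hσ : ∀ x, π (σ (π x)) = π x := by
      intro x
      have h : ∃ x', π x' = π x := ⟨x, rfl⟩
      simp only [σ, h, dif_pos]
      exact h.choose_spec
    have hval : ∀ x y, θ (σ (π x)) (σ (π y)) = θ x y := fun x y => hwd _ _ _ _ (hσ x) (hσ y)
    refine ⟨fun v w => θ (σ v) (σ w), ?_⟩
    intro a ha b hb c hc
    obtain ⟨x, rfl⟩ := hπ a ha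
    obtain ⟨y, rfl⟩ := hπ b hb
    obtain ⟨z, rfl⟩ := hπ c hc
    simp only [← map_add, hval]
    refine ⟨by simp, by simp, fun h => h1 _ _ h, h2 _ _⟩
  obtain ⟨θ, hθ⟩ := IsCompact.nonempty_iInter_of_directed_nonempty_isCompact_isClosed K
    (fun S S' => ⟨S ∪ S', hanti _ _ Finset.subset_union_left, hanti _ _ Finset.subset_union_right⟩)
    hne (fun S => (hcl S).isCompact) hcl
  rw [Set.mem_iInter] at hθ
  have hall : ∀ a b c, θ (a + b) c = θ a c + θ b c ∧ θ c (a + b) = θ c a + θ c b ∧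
      (b ∈ B → θ a b = 0) ∧ θ a b - θ b a = ω a b := by
    intro a b c
    refine hθ {a, b, c} a (AddSubgroup.subset_closure (by simp)) b
      (AddSubgroup.subset_closure (by simp)) c (AddSubgroup.subset_closure (by simp))
  refine ⟨AddMonoidHom.mk' (fun a => AddMonoidHom.mk' (θ a) fun b c => (hall b c a).2.1) ?_, ?_, ?_⟩
  · intro a b
    ext c
    exact (hall a b c).1
  · intro x y hy
    exact (hall x y 0).2.2.1 hy
  · intro x y
    exact (hall x y 0).2.2.2

end Nil2Aux

namespace Nil2Aux

open scoped commutatorElement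

abbrev MT := Multiplicative UnitAddCircle

theorem hom_ab_eq {A T : Type*} [Group A] [CommGroup T] (f : A →* T) {a b : A}
    (h : Abelianization.of a = Abelianization.of b) : f a = f b := by
  rw [← mem_comm_iff] at h
  have := hom_commutator f h
  rwa [map_mul, map_inv, mul_inv_eq_one] at this

theorem divisible_extend {X Y : Type*} [CommGroup X] [CommGroup Y] (i : X →* Y)
    (hi : Function.Injective i) (f : X →* MT) : ∃ g : Y →* MT, ∀ x, g (i x) = f x := by
  obtain ⟨g, hg⟩ := (Module.Baer.of_divisible UnitAddCircle).extension_property_addMonoidHom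
    (MonoidHom.toAdditive i) hi (MonoidHom.toAdditiveLeft f)
  refine ⟨AddMonoidHom.toMultiplicativeRight g, fun x => ?_⟩
  exact congrArg (fun w => w (Additive.ofMul x)) hg

theorem extend_hom {E : Type*} [Group E] (L : Subgroup E) (l : L →* MT)
    (hl : ∀ p : L, (p : E) ∈ commutator E → l p = 1) :
    ∃ ρ : E →* MT, ∀ p : L, ρ p = l p := by
  let f : L →* Abelianization E := Abelianization.of.comp L.subtype
  have hker : f.rangeRestrict.ker ≤ l.ker := by
    intro p hp
    rw [MonoidHom.ker_rangeRestrict] at hp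
    apply hl
    rw [← Abelianization.ker_of]
    exact hp
  let l' : f.range →* MT := f.rangeRestrict.liftOfSurjective f.rangeRestrict_surjective ⟨l, hker⟩
  have hl' : ∀ p, l' (f.rangeRestrict p) = l p := fun p =>
    MonoidHom.liftOfRightInverse_comp_apply _ _ _ _ _
  obtain ⟨g, hg⟩ := divisible_extend f.range.subtype Subtype.val_injective l'
  refine ⟨g.comp Abelianization.of, fun p => ?_⟩
  rw [← hl', ← hg]
  rfl

theorem exists_char {Z : Type*} [CommGroup Z] (H : Subgroup Z) (c : Z) (hc : c ∉ H) :
    ∃ χ : Z →* MT, (∀ z ∈ H, χ z = 1) ∧ χ c ≠ 1 := by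
  have hne : (Additive.ofMul (QuotientGroup.mk c : Z ⧸ H)) ≠ 0 := by
    intro h
    exact hc ((QuotientGroup.eq_one_iff c).1 h)
  obtain ⟨ch, hch⟩ := CharacterModule.exists_character_apply_ne_zero_of_ne_zero hne
  let j : AddCircle (1 : ℚ) →+ UnitAddCircle :=
    QuotientAddGroup.map _ _ (Rat.castHom ℝ).toAddMonoidHom (by
      intro q hq
      obtain ⟨m, rfl⟩ := hq
      exact ⟨m, by simp⟩)
  have hj : ∀ q, j q = 0 → q = 0 := by
    intro q
    induction q using QuotientAddGroup.induction_on with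
    | H q =>
      intro h
      have h' : ((q : ℝ) : UnitAddCircle) = 0 := h
      rw [QuotientAddGroup.eq_zero_iff] at h' ⊢
      obtain ⟨m, hm⟩ := h'
      refine ⟨m, ?_⟩
      simp only [zsmul_eq_mul, mul_one] at hm ⊢
      exact_mod_cast hm
  let ch' : Additive (Z ⧸ H) →+ UnitAddCircle := j.comp ch
  refine ⟨(AddMonoidHom.toMultiplicativeRight ch').comp (QuotientGroup.mk' H), ?_, ?_⟩
  · intro z hz
    have : QuotientGroup.mk' H z = 1 := (QuotientGroup.eq_one_iff z).2 hz
    rw [MonoidHom.comp_apply, this, map_one]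
  · intro h
    exact hch (hj _ h)

theorem exists_theta_mul {A : Type*} [Group A] (hA : IsNil2 A) (H : Subgroup A)
    (hH : ∀ (n : ℕ) (r s h k : A), 0 < n → h ∈ H → k ∈ H →
      Abelianization.of h = Abelianization.of (r ^ n) →
      Abelianization.of k = Abelianization.of (s ^ n) → cm r s ^ n ∈ H)
    (χ : Subgroup.center A →* MT) (hχ : ∀ z : Subgroup.center A, (z : A) ∈ H → χ z = 1) :
    ∃ θ : A →* A →* MT, (∀ a, ∀ h ∈ H, θ a h = 1) ∧
      ∀ a b, θ a b * (θ b a)⁻¹ = χ (bil hA a b) := by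
  let γ : A →* A →* MT := MonoidHom.mk' (fun a => χ.comp (bil hA a)) (by
    intro a b; ext c; simp)
  have hγ : ∀ a b, γ a b = χ (bil hA a b) := fun _ _ => rfl
  let V := Additive (Abelianization A)
  let q : A → V := fun a => Additive.ofMul (Abelianization.of a)
  have hq : Function.Surjective q := fun v => by
    obtain ⟨a, ha⟩ := QuotientGroup.mk_surjective (s := commutator A) v.toMul
    exact ⟨a, ha⟩
  let s : V → A := Function.surjInv hq
  have hs : ∀ v, q (s v) = v := Function.surjInv_eq hq
  have hγq : ∀ a a' b b', q a = q a' → q b = q b' → γ a b = γ a' b' := by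
    intro a a' b b' h h'
    have h1 : γ a = γ a' := hom_ab_eq γ h
    have h2 : γ a' b = γ a' b' := hom_ab_eq (γ a') h'
    rw [h1, h2]
  have hqm : ∀ a b, q (a * b) = q a + q b := fun a b => by simp [q]
  have hqp : ∀ a (n : ℕ), q (a ^ n) = n • q a := fun a n => by simp [q]
  let ω : V →+ V →+ UnitAddCircle := AddMonoidHom.mk' (fun v => AddMonoidHom.mk'
    (fun w => Multiplicative.toAdd (γ (s v) (s w))) (by
      intro w w'
      rw [← toAdd_mul, ← map_mul]
      congr 1
      apply hγq _ _ _ _ rfl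
      rw [hqm, hs, hs, hs])) (by
    intro v v'
    refine AddMonoidHom.ext fun w => ?_
    change Multiplicative.toAdd (γ (s (v + v')) (s w)) =
      Multiplicative.toAdd (γ (s v) (s w)) + Multiplicative.toAdd (γ (s v') (s w))
    rw [← toAdd_mul, ← MonoidHom.mul_apply, ← map_mul]
    congr 1
    apply hγq _ _ _ _ _ rfl
    rw [hqm, hs, hs, hs])
  have hωq : ∀ a b, ω (q a) (q b) = Multiplicative.toAdd (γ a b) := by
    intro a b
    change Multiplicative.toAdd (γ (s (q a)) (s (q b))) = _
    rw [hγq _ _ _ _ (hs (q a)) (hs (q b))]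
  let B : AddSubgroup V := Subgroup.toAddSubgroup (H.map Abelianization.of)
  have hBq : ∀ v, v ∈ B → ∃ h ∈ H, q h = v := fun v hv => hv
  obtain ⟨θ, hθ1, hθ2⟩ := exists_theta B ω (by
      intro v
      obtain ⟨a, rfl⟩ := hq v
      rw [hωq, hγ, bil_self, map_one, toAdd_one]) (by
      intro n v w hn hv hw
      obtain ⟨r, rfl⟩ := hq v
      obtain ⟨t, rfl⟩ := hq w
      obtain ⟨h, hh, hh'⟩ := hBq _ hv
      obtain ⟨k, hk, hk'⟩ := hBq _ hw
      rw [← hqp] at hh' hk'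
      have := hH n r t h k hn hh hk hh' hk'
      rw [hωq, ← toAdd_pow, hγ, ← map_pow, hχ, toAdd_one]
      exact this)
  refine ⟨MonoidHom.mk' (fun a => MonoidHom.mk' (fun b => Multiplicative.ofAdd (θ (q a) (q b)))
    ?_) ?_, ?_, ?_⟩
  · intro b c
    rw [hqm, map_add, ofAdd_add]
  · intro a b
    ext c
    change Multiplicative.ofAdd (θ (q (a * b)) (q c)) =
      Multiplicative.ofAdd (θ (q a) (q c)) * Multiplicative.ofAdd (θ (q b) (q c))
    rw [hqm, map_add, AddMonoidHom.add_apply, ofAdd_add]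
  · intro a h hh
    change Multiplicative.ofAdd (θ (q a) (q h)) = 1
    rw [hθ1 (q a) (q h) ⟨h, hh, rfl⟩, ofAdd_zero]
  · intro a b
    change Multiplicative.ofAdd (θ (q a) (q b)) * (Multiplicative.ofAdd (θ (q b) (q a)))⁻¹ = _
    rw [← ofAdd_neg, ← ofAdd_add, ← sub_eq_add_neg, hθ2, hωq, ofAdd_toAdd, hγ]

theorem exists_delta {A : Type*} [Group A] (hA : IsNil2 A) (H : Subgroup A)
    (χ : Subgroup.center A →* MT) (hχ : ∀ z : Subgroup.center A, (z : A) ∈ H → χ z = 1)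
    (θ : A →* A →* MT) (hθ : ∀ a, ∀ h ∈ H, θ a h = 1)
    (hθ2 : ∀ a b, θ a b * (θ b a)⁻¹ = χ (bil hA a b)) :
    ∃ δ : A → MT, (∀ a b, δ (a * b) = δ a * δ b * θ b a) ∧ (∀ h ∈ H, δ h = 1) ∧
      ∀ z : Subgroup.center A, (z : A) ∈ commutator A → δ z = (χ z)⁻¹ := by
  let L : Subgroup (CExt θ.flip) := H.comap CExt.fst
  let l : L →* MT := MonoidHom.mk' (fun p => p.1.t) (by
    intro p q
    change p.1.t * q.1.t * θ q.1.a p.1.a = _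
    rw [hθ q.1.a p.1.a p.2, mul_one])
  have hE : ∀ p ∈ commutator (CExt θ.flip), ∃ z : Subgroup.center A, (z : A) ∈ commutator A ∧
      p = ⟨z, (χ z)⁻¹⟩ := by
    let K : Subgroup (CExt θ.flip) :=
      { carrier := {p | ∃ z : Subgroup.center A, (z : A) ∈ commutator A ∧ p = ⟨z, (χ z)⁻¹⟩}
        one_mem' := ⟨1, one_mem _, by ext <;> simp⟩
        mul_mem' := by
          rintro _ _ ⟨z, hz, rfl⟩ ⟨w, hw, rfl⟩
          refine ⟨z * w, mul_mem hz hw, ?_⟩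
          ext
          · simp
          · simp [hom2_commutator_left θ hw, mul_comm]
        inv_mem' := by
          rintro _ ⟨z, hz, rfl⟩
          refine ⟨z⁻¹, inv_mem hz, ?_⟩
          ext
          · simp
          · simp [hom2_commutator_left θ hz] }
    have : commutator (CExt θ.flip) ≤ K := by
      rw [commutator_def, Subgroup.commutator_le]
      intro p _ q _
      have e : ⁅p, q⁆ = cm p⁻¹ q⁻¹ := by simp [cm, commutatorElement_def]
      rw [e, CExt.cm_eq]
      refine ⟨bil hA p⁻¹.a q⁻¹.a, cm_mem _ _, ?_⟩
      ext
      · rfl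
      · rw [← hθ2]
        simp
    exact this
  obtain ⟨ρ, hρ⟩ := extend_hom L l (by
    rintro ⟨p, hp⟩ hpc
    obtain ⟨z, hz, rfl⟩ := hE p hpc
    change (χ z)⁻¹ = 1
    rw [hχ z hp, inv_one])
  have hρt : ∀ a t, ρ ⟨a, t⟩ = ρ ⟨a, 1⟩ * t := by
    intro a t
    have h1 : (⟨a, t⟩ : CExt θ.flip) = ⟨a, 1⟩ * ⟨1, t⟩ := by ext <;> simp
    have h2 : ρ ⟨1, t⟩ = t := hρ ⟨⟨1, t⟩, H.one_mem⟩
    rw [h1, map_mul, h2]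
  refine ⟨fun a => (ρ ⟨a, 1⟩)⁻¹, ?_, ?_, ?_⟩
  · intro a b
    have h1 : (⟨a, 1⟩ * ⟨b, 1⟩ : CExt θ.flip) = ⟨a * b, θ b a⟩ := by ext <;> simp
    have h2 := congrArg ρ h1
    rw [map_mul, hρt (a * b)] at h2
    simp only
    rw [← mul_inv, h2]
    simp
  · intro h hh
    have : ρ ⟨h, 1⟩ = 1 := hρ ⟨⟨h, 1⟩, hh⟩
    simp only
    rw [this, inv_one]
  · intro z hz
    have hsurj : Function.Surjective (CExt.fst : CExt θ.flip →* A) := fun a => ⟨⟨a, 1⟩, rfl⟩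
    have hmap : (commutator (CExt θ.flip)).map (CExt.fst : CExt θ.flip →* A) = commutator A := by
      rw [commutator_def, commutator_def, Subgroup.map_commutator,
        Subgroup.map_top_of_surjective _ hsurj]
    rw [← hmap] at hz
    obtain ⟨p, hp, hpz⟩ := hz
    obtain ⟨w, hw, rfl⟩ := hE p hp
    have hwz : w = z := Subtype.ext hpz
    subst hwz
    have h1 := hom_commutator ρ hp
    rw [hρt] at h1
    simp only
    rw [mul_inv_eq_one.1 h1]

def pairβ (A : Type u) [Group A] : (A × (A →* MT)) →* (A × (A →* MT)) →* MT :=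
  MonoidHom.mk' (fun p => p.2.comp (MonoidHom.fst _ _)) (by
    intro p q; ext r; simp)

theorem pairβ_apply (A : Type u) [Group A] (p q : A × (A →* MT)) :
    pairβ A p q = p.2 q.1 := rfl

theorem dominion_comm {A : Type u} [Group A] (hA : IsNil2 A) (H : Subgroup A)
    (hH : ∀ (n : ℕ) (r s h k : A), 0 < n → h ∈ H → k ∈ H →
      Abelianization.of h = Abelianization.of (r ^ n) →
      Abelianization.of k = Abelianization.of (s ^ n) → cm r s ^ n ∈ H)
    (c : A) (hc : c ∈ commutator A) (hd : c ∈ Dominion H) : c ∈ H := by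
  by_contra hcH
  obtain ⟨χ, hχ, hχc⟩ := exists_char (H.subgroupOf (Subgroup.center A)) ⟨c, hA hc⟩ hcH
  have hχ' : ∀ z : Subgroup.center A, (z : A) ∈ H → χ z = 1 := fun z hz => hχ z hz
  obtain ⟨θ, hθ1, hθ2⟩ := exists_theta_mul hA H hH χ hχ'
  obtain ⟨δ, hδ1, hδ2, hδ3⟩ := exists_delta hA H χ hχ' θ hθ1 hθ2
  have hC : IsNil2 (CExt (pairβ A)) := CExt.nil2 (nil2_prod hA nil2_comm)
  let f : A →* CExt (pairβ A) := MonoidHom.mk' (fun a => ⟨(a, 1), 1⟩) (by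
    intro a b
    refine CExt.ext (Prod.ext rfl (mul_one _).symm) ?_
    rw [CExt.mul_t, pairβ_apply]
    simp)
  let g : A →* CExt (pairβ A) := MonoidHom.mk' (fun a => ⟨(a, θ.flip a), δ a⟩) (by
    intro a b
    refine CExt.ext (Prod.ext rfl (map_mul θ.flip a b)) ?_
    rw [CExt.mul_t, pairβ_apply]
    exact hδ1 a b)
  have hfg := hd (CExt (pairβ A)) hC f g (by
    intro h hh
    ext
    · rfl
    · change 1 = θ _ h
      rw [hθ1 _ h hh]
    · exact (hδ2 h hh).symm)
  have h1 : (1 : MT) = δ c := congrArg CExt.t hfg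
  have h2 := hδ3 ⟨c, hA hc⟩ hc
  simp only at h2
  rw [← h1] at h2
  exact hχc (inv_eq_one.1 h2.symm)

theorem dominion_le {A : Type u} [Group A] (hA : IsNil2 A) (H : Subgroup A)
    (hH : ∀ (n : ℕ) (r s h k : A), 0 < n → h ∈ H → k ∈ H →
      Abelianization.of h = Abelianization.of (r ^ n) →
      Abelianization.of k = Abelianization.of (s ^ n) → cm r s ^ n ∈ H)
    (a : A) (hd : a ∈ Dominion H) : a ∈ H := by
  have h1 := hd (Abelianization A ⧸ H.map Abelianization.of) nil2_comm
    ((QuotientGroup.mk' (H.map Abelianization.of)).comp Abelianization.of) 1 (by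
      intro b hb
      exact (QuotientGroup.eq_one_iff _).2 ⟨b, hb, rfl⟩)
  obtain ⟨h, hh, hha⟩ := (QuotientGroup.eq_one_iff _).1 h1
  have hc : h⁻¹ * a ∈ H := by
    apply dominion_comm hA H hH
    · rw [← Abelianization.ker_of, MonoidHom.mem_ker, map_mul, map_inv, hha, inv_mul_cancel]
    · intro C _ hC f g hfg
      rw [map_mul, map_mul, hd C hC f g hfg, hfg _ (H.inv_mem hh)]
  have := H.mul_mem hh hc
  rwa [mul_inv_cancel_left] at this

theorem root_calc {A : Type u} [Group A] (hA : IsNil2 A) (n : ℕ) (r s x y g₁ g₂ : A) (a b b' c : ℤ)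
    (hx : Abelianization.of x = Abelianization.of (r ^ n))
    (hy : Abelianization.of y = Abelianization.of (s ^ n))
    (h1 : Abelianization.of (g₁ ^ n) = Abelianization.of (x ^ a * y ^ b))
    (h2 : Abelianization.of (g₂ ^ n) = Abelianization.of (x ^ b' * y ^ c)) :
    bil hA g₁ x * bil hA g₂ y = (bil hA r s ^ n) ^ (b' - b) := by
  have hx' : bil hA x = bil hA r ^ n := by rw [hom_ab_eq (bil hA) hx, map_pow]
  have hy' : bil hA y = bil hA s ^ n := by rw [hom_ab_eq (bil hA) hy, map_pow]
  have e1 : bil hA g₁ ^ n = bil hA x ^ a * bil hA y ^ b := by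
    rw [← map_pow, hom_ab_eq (bil hA) h1, map_mul, map_zpow, map_zpow]
  have e2 : bil hA g₂ ^ n = bil hA x ^ b' * bil hA y ^ c := by
    rw [← map_pow, hom_ab_eq (bil hA) h2, map_mul, map_zpow, map_zpow]
  have e3 : bil hA g₁ x = (bil hA g₁ ^ n) r := by
    rw [hom_ab_eq (bil hA g₁) hx, map_pow]; rfl
  have e4 : bil hA g₂ y = (bil hA g₂ ^ n) s := by
    rw [hom_ab_eq (bil hA g₂) hy, map_pow]; rfl
  rw [e3, e4, e1, e2, hx', hy']
  simp only [MonoidHom.mul_apply, MonoidHom.zpow_apply, MonoidHom.pow_apply, bil_self, one_pow,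
    one_zpow, one_mul, mul_one]
  rw [bil_symm hA s r, inv_pow, inv_zpow, ← zpow_neg, ← zpow_add]
  congr 1
  ring

theorem map_of_eq {G A : Type*} [Group G] [Group A] (f : G →* A) {a b : G}
    (h : a * b⁻¹ ∈ commutator G) : Abelianization.of (f a) = Abelianization.of (f b) := by
  rw [mem_comm_iff] at h
  exact hom_ab_eq (Abelianization.of.comp f) h

theorem closed_of_conditions {G : Type u} [Group G]
    (h : ∀ (x y : G) (n : ℕ), 0 < n → (Cond210 x y n ∨ Cond211 x y n)) :
    IsAbsolutelyClosed G := by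
  intro A _ hA io hio
  apply Set.Subset.antisymm
  · intro a ha
    refine dominion_le hA io.range ?_ a ha
    rintro n r s _ _ hn ⟨x, rfl⟩ ⟨y, rfl⟩ hx hy
    rcases h x y n hn with ⟨a, b, c, g₁, g₂, h1, h2, h3⟩ | ⟨a, b, c, g₁, g₂, h1, h2⟩
    · exfalso
      have k1 := map_of_eq io h1
      have k2 := map_of_eq io h2
      simp only [map_mul io, map_pow io, map_zpow io] at k1 k2
      have := root_calc hA n r s (io x) (io y) (io g₁) (io g₂) a b b c hx hy k1 k2
      rw [sub_self, zpow_zero] at this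
      have := congrArg Subtype.val this
      change cm (io g₁) (io x) * cm (io g₂) (io y) = 1 at this
      rw [← map_cm, ← map_cm, ← map_mul] at this
      exact h3 (hio (this.trans (map_one io).symm))
    · have k1 := map_of_eq io h1
      have k2 := map_of_eq io h2
      simp only [map_mul io, map_pow io, map_zpow io] at k1 k2
      have := root_calc hA n r s (io x) (io y) (io g₁) (io g₂) a b (b + 1) c hx hy k1 k2
      rw [add_sub_cancel_left, zpow_one] at this
      have := congrArg Subtype.val this
      change cm (io g₁) (io x) * cm (io g₂) (io y) = cm r s ^ n at this
      rw [← this, ← map_cm, ← map_cm, ← map_mul]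
      exact ⟨_, rfl⟩
  · intro a ha C _ hC f g hfg
    exact hfg a ha

end Nil2Aux
/-- A nil-2 group `G` is absolutely closed in `N₂` iff for all `x y ∈ G` and all
`n > 0`, condition (2.10) or condition (2.11) holds. -/
theorem absolutelyClosed_iff_conditions {G : Type u} [Group G] (hG : IsNil2 G) :
    IsAbsolutelyClosed G ↔
      ∀ (x y : G) (n : ℕ), 0 < n → (Cond210 x y n ∨ Cond211 x y n) := by
  constructor
  · intro hcl x y n hn
    by_contra hcon
    rw [not_or] at hcon
    exact Nil2Aux.not_closed hG x y n hn hcon.1 hcon.2 hcl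
  · exact Nil2Aux.closed_of_conditions
end

section
/- Let G be a group of nilpotency class at most 2 such that for every x ∈ G and every integer n > 0, either x has an n-th root in G modulo the commutator subgroup (i.e., there exist r ∈ G and r' ∈ [G,G] with x = r^n r'), or else x has no n-th root in any overgroup of G of nilpotency class at most 2 (i.e., for every group K of nilpotency class at most 2 containing G as a subgroup and every k ∈ K, k^n ≠ x). Then G is absolutely closed in N₂. -/
universe u

open scoped commutatorElement

lemma normal_of_le_center_aux {G : Type*} [Group G] {N : Subgroup G}
    (h : N ≤ Subgroup.center G) : N.Normal :=
  ⟨fun n hn g => by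
    rw [Subgroup.mem_center_iff.1 (h hn) g, mul_inv_cancel_right]; exact hn⟩

/-- Nil-2 in terms of elements. -/
lemma isNil2_iff {G : Type*} [Group G] :
    IsNil2 G ↔ ∀ x y z : G, ⁅x, y⁆ * z = z * ⁅x, y⁆ := by
  unfold IsNil2
  rw [commutator_def, Subgroup.commutator_le]
  constructor
  · intro h x y z
    exact ((Subgroup.mem_center_iff.1 (h x trivial y trivial)) z).symm
  · intro h x _ y _
    exact Subgroup.mem_center_iff.2 fun z => (h x y z).symm

lemma IsNil2.prod {G H : Type*} [Group G] [Group H] (hG : IsNil2 G) (hH : IsNil2 H) :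
    IsNil2 (G × H) := by
  rw [isNil2_iff] at *
  intro x y z
  exact Prod.ext (hG x.1 y.1 z.1) (hH x.2 y.2 z.2)

lemma IsNil2.of_surjective {G H : Type*} [Group G] [Group H] (hG : IsNil2 G) (f : G →* H)
    (hf : Function.Surjective f) : IsNil2 H := by
  rw [isNil2_iff] at *
  intro x y z
  obtain ⟨x, rfl⟩ := hf x
  obtain ⟨y, rfl⟩ := hf y
  obtain ⟨z, rfl⟩ := hf z
  rw [← map_commutatorElement, ← map_mul, ← map_mul, hG]

lemma IsNil2.of_comm {G : Type*} [CommGroup G] : IsNil2 G := by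
  rw [isNil2_iff]
  intro x y z
  exact mul_comm _ _

lemma IsNil2.germ {ι : Type*} (l : Filter ι) {G : Type*} [Group G] (hG : IsNil2 G) :
    IsNil2 (l.Germ G) := by
  rw [isNil2_iff] at *
  intro x y z
  induction x using Filter.Germ.inductionOn with | _ x
  induction y using Filter.Germ.inductionOn with | _ y
  induction z using Filter.Germ.inductionOn with | _ z
  simp only [commutatorElement_def, ← Filter.Germ.coe_mul, ← Filter.Germ.coe_inv]
  congr 1
  funext i
  exact hG (x i) (y i) (z i)

/-- A central element of a nil-2 group has an `n`-th root, central, in a nil-2 overgroup. -/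
lemma exists_overgroup {A : Type u} [Group A] (hA : IsNil2 A) (c : A)
    (hc : c ∈ Subgroup.center A) (n : ℕ) (hn : 0 < n) :
    ∃ (K : Type u) (_ : Group K) (j : A →* K) (d : K), IsNil2 K ∧ Function.Injective j ∧
      (∀ k, d * k = k * d) ∧ d ^ n = j c := by
  let g : A × Multiplicative ℤ := (c, Multiplicative.ofAdd (-(n : ℤ)))
  have hg : Subgroup.zpowers g ≤ Subgroup.center _ := by
    rw [Subgroup.zpowers_le, Subgroup.mem_center_iff]
    intro k
    exact Prod.ext (Subgroup.mem_center_iff.1 hc k.1) (mul_comm _ _)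
  have hN : (Subgroup.zpowers g).Normal := normal_of_le_center_aux hg
  refine ⟨(A × Multiplicative ℤ) ⧸ Subgroup.zpowers g, inferInstance,
    (QuotientGroup.mk' _).comp (MonoidHom.inl _ _),
    QuotientGroup.mk' _ (1, Multiplicative.ofAdd 1), ?_, ?_, ?_, ?_⟩
  · exact (hA.prod IsNil2.of_comm).of_surjective _ (QuotientGroup.mk'_surjective _)
  · rw [injective_iff_map_eq_one]
    intro a ha
    have : ((a, 1) : A × Multiplicative ℤ) ∈ Subgroup.zpowers g :=
      (QuotientGroup.eq_one_iff _).1 ha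
    obtain ⟨k, hk⟩ := Subgroup.mem_zpowers_iff.1 this
    have h1 : c ^ k = a := congrArg Prod.fst hk
    have h2 : k * (-(n : ℤ)) = 0 := by
      have := congrArg (fun z => Multiplicative.toAdd (Prod.snd z)) hk
      simpa [g] using this
    have : k = 0 := by
      rcases mul_eq_zero.1 h2 with h | h
      · exact h
      · omega
    rw [← h1, this, zpow_zero]
  · intro k
    obtain ⟨k, rfl⟩ := QuotientGroup.mk'_surjective _ k
    rw [← map_mul, ← map_mul]
    congr 1
    exact Prod.ext (by simp) (mul_comm _ _)
  · rw [← map_pow]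
    show _ = QuotientGroup.mk' _ (c, 1)
    rw [QuotientGroup.mk'_apply, QuotientGroup.mk'_apply, QuotientGroup.eq]
    convert Subgroup.mem_zpowers g using 1
    refine Prod.ext (by simp [g]) ?_
    apply Multiplicative.toAdd.injective
    simp [g]

/-- Finitely generated subgroups of the quotient by a pure subgroup lift. -/
lemma exists_section {W : Type*} [AddCommGroup W] (B : AddSubgroup W)
    (hB : ∀ (w : W) (n : ℕ), 0 < n → n • w ∈ B → ∃ b ∈ B, n • w = n • b)
    (V : Type*) [AddCommGroup V] [AddGroup.FG V] (i : V →+ W ⧸ B) :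
    ∃ s : V →+ W, ∀ v, (s v : W ⧸ B) = i v := by
  obtain ⟨n, ι, _, p, hp, e, ⟨E⟩⟩ := AddCommGroup.equiv_free_prod_directSum_zmod V
  classical
  -- the free part
  have h1 : ∃ s1 : (Fin n →₀ ℤ) →+ W, ∀ x, (s1 x : W ⧸ B) = i (E.symm (x, 0)) := by
    choose f hf using fun k : Fin n =>
      QuotientAddGroup.mk_surjective (i (E.symm (Finsupp.single k 1, 0)))
    let s1 : (Fin n →₀ ℤ) →+ W := Finsupp.liftAddHom fun k => (zmultiplesHom W) (f k)
    refine ⟨s1, fun x => ?_⟩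
    have : (QuotientAddGroup.mk' B).comp s1 =
        (i.comp E.symm.toAddMonoidHom).comp (AddMonoidHom.inl _ _) := by
      ext k
      simp [s1, hf]
    exact DFunLike.congr_fun this x
  have h2 : ∃ s2 : (DirectSum ι fun k => ZMod (p k ^ e k)) →+ W,
      ∀ x, (s2 x : W ⧸ B) = i (E.symm (0, x)) := by
    have : ∀ k : ι, ∃ t : ZMod (p k ^ e k) →+ W,
        ∀ x, (t x : W ⧸ B) = i (E.symm (0, DirectSum.of _ k x)) := by
      intro k
      obtain ⟨w, hw⟩ := QuotientAddGroup.mk_surjective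
        (i (E.symm (0, DirectSum.of (fun k => ZMod (p k ^ e k)) k 1)))
      have hpos : 0 < p k ^ e k := pow_pos (hp k).pos _
      have hwB : (p k ^ e k) • w ∈ B := by
        rw [← QuotientAddGroup.eq_zero_iff, QuotientAddGroup.mk_nsmul, hw, ← map_nsmul,
          ← map_nsmul, Prod.smul_mk, ← map_nsmul]
        have h0 : (p k ^ e k) • (1 : ZMod (p k ^ e k)) = 0 := by
          rw [nsmul_eq_mul, ZMod.natCast_self, zero_mul]
        rw [h0, map_zero, smul_zero]
        exact (i.comp E.symm.toAddMonoidHom).map_zero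
      obtain ⟨b, hb, hwb⟩ := hB w _ hpos hwB
      let t : ZMod (p k ^ e k) →+ W := ZMod.lift (p k ^ e k)
        ⟨(zmultiplesHom W) (w - b), by
          rw [zmultiplesHom_apply, natCast_zsmul, smul_sub, hwb, sub_self]⟩
      refine ⟨t, fun x => ?_⟩
      obtain ⟨m, rfl⟩ := ZMod.intCast_surjective x
      have h3 : ((w - b : W) : W ⧸ B) = w := by
        rw [QuotientAddGroup.mk_sub, (QuotientAddGroup.eq_zero_iff b).2 hb, sub_zero]
      have h4 : t (m : ZMod _) = m • (w - b) := by simp [t]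
      have h5 : (m : ZMod (p k ^ e k)) = m • 1 := by simp
      rw [h4, QuotientAddGroup.mk_zsmul, h3, hw, ← map_zsmul, ← map_zsmul, Prod.smul_mk,
        ← map_zsmul, h5, smul_zero]
    choose t ht using this
    refine ⟨DirectSum.toAddMonoid t, fun x => ?_⟩
    have : (QuotientAddGroup.mk' B).comp (DirectSum.toAddMonoid t) =
        (i.comp E.symm.toAddMonoidHom).comp (AddMonoidHom.inr _ _) := by
      refine DirectSum.addHom_ext fun k y => ?_
      simp [ht]
    exact DFunLike.congr_fun this x
  obtain ⟨s1, hs1⟩ := h1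
  obtain ⟨s2, hs2⟩ := h2
  refine ⟨(s1.coprod s2).comp E.toAddMonoidHom, fun v => ?_⟩
  obtain ⟨⟨x, y⟩, rfl⟩ := E.symm.surjective v
  have : ((x, y) : (Fin n →₀ ℤ) × _) = (x, 0) + (0, y) := by simp
  simp only [AddMonoidHom.comp_apply, AddEquiv.coe_toAddMonoidHom, AddEquiv.apply_symm_apply,
    AddMonoidHom.coprod_apply, QuotientAddGroup.mk_add, hs1, hs2]
  rw [this, map_add, map_add]

/-- If the image of `B` in the abelianization of `A` is pure, then `B` equals its dominion. -/
lemma dominion_of_pure {A : Type u} [Group A] (hA : IsNil2 A) (B : Subgroup A)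
    (hB : ∀ (x : A) (n : ℕ), 0 < n → ∀ b ∈ B, ∀ c ∈ commutator A, x ^ n = b * c →
      ∃ r ∈ B, ∃ c' ∈ commutator A, x ^ n = r ^ n * c') :
    Dominion B = (B : Set A) := by
  classical
  refine Set.Subset.antisymm ?_ (fun a ha C _ _ f g hfg => hfg a ha)
  intro a ha
  let W := Additive (Abelianization A)
  let π : A → W := fun x => Additive.ofMul (Abelianization.of x)
  have πmul : ∀ x y, π (x * y) = π x + π y := fun x y => by simp [π]
  have πpow : ∀ x (n : ℕ), π (x ^ n) = n • π x := fun x n => by simp [π]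
  have πsurj : Function.Surjective π := fun w => by
    obtain ⟨x, hx⟩ := QuotientGroup.mk_surjective (Additive.toMul w)
    exact ⟨x, hx⟩
  have πeq : ∀ x y, π x = π y → x⁻¹ * y ∈ commutator A := fun x y h =>
    QuotientGroup.eq.1 h
  have πeq' : ∀ x y, x⁻¹ * y ∈ commutator A → π x = π y := fun x y h =>
    QuotientGroup.eq.2 h
  let Bb : AddSubgroup W := (B.map Abelianization.of).toAddSubgroup
  have memBb : ∀ w, w ∈ Bb ↔ ∃ b ∈ B, π b = w := fun w => Iff.rfl
  have pure : ∀ (w : W) (n : ℕ), 0 < n → n • w ∈ Bb → ∃ b ∈ Bb, n • w = n • b := by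
    intro w n hn hw
    obtain ⟨x, rfl⟩ := πsurj w
    obtain ⟨b, hb, hbx⟩ := (memBb _).1 hw
    rw [← πpow] at hbx
    obtain ⟨r, hr, c', hc', e⟩ := hB x n hn b hb _ (πeq _ _ hbx) (by group)
    refine ⟨π r, (memBb _).2 ⟨r, hr, rfl⟩, ?_⟩
    rw [← πpow, ← πpow]
    refine (πeq' _ _ ?_).symm
    rw [e]; simpa using hc'
  have hs : ∀ S : Finset (W ⧸ Bb), ∃ s : AddSubgroup.closure (S : Set (W ⧸ Bb)) →+ W,
      ∀ v, (s v : W ⧸ Bb) = v := by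
    intro S
    have : AddGroup.FG (AddSubgroup.closure (S : Set (W ⧸ Bb))) :=
      (AddGroup.fg_iff_addSubgroup_fg _).2 ⟨S, rfl⟩
    exact exists_section Bb pure (AddSubgroup.closure (S : Set (W ⧸ Bb)))
      (AddSubgroup.subtype (AddSubgroup.closure (S : Set (W ⧸ Bb))))
  choose s hs using hs
  let N : Subgroup A := B ⊓ commutator A
  have : N.Normal := normal_of_le_center_aux (inf_le_right.trans hA)
  have hτ : ∀ w : W, ∃ b : A, w ∈ Bb → b ∈ B ∧ π b = w := by
    intro w
    by_cases h : w ∈ Bb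
    · obtain ⟨b, hb⟩ := (memBb _).1 h
      exact ⟨b, fun _ => hb⟩
    · exact ⟨1, fun h' => absurd h' h⟩
  choose τ hτ using hτ
  have mkeq : ∀ b ∈ B, ∀ b' ∈ B, π b = π b' → (b : A ⧸ N) = b' := by
    intro b hb b' hb' h
    exact QuotientGroup.eq.2 ⟨B.mul_mem (B.inv_mem hb) hb', πeq _ _ h⟩
  let q : A → W ⧸ Bb := fun x => (π x : W ⧸ Bb)
  have qmul : ∀ x y, q (x * y) = q x + q y := fun x y => by simp [q, πmul]
  let ρ : A → Finset (W ⧸ Bb) → A ⧸ N := fun x S =>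
    if h : q x ∈ AddSubgroup.closure (S : Set (W ⧸ Bb)) then
      ((τ (π x - s S ⟨q x, h⟩) : A) : A ⧸ N) else 1
  have hmem : ∀ x (S : Finset (W ⧸ Bb)) (h : q x ∈ AddSubgroup.closure (S : Set (W ⧸ Bb))),
      π x - s S ⟨q x, h⟩ ∈ Bb := by
    intro x S h
    rw [← QuotientAddGroup.eq_zero_iff, QuotientAddGroup.mk_sub, hs]
    simp [q]
  have hev : ∀ x, ∀ᶠ S : Finset (W ⧸ Bb) in Filter.atTop,
      q x ∈ AddSubgroup.closure (S : Set (W ⧸ Bb)) := by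
    intro x
    filter_upwards [Filter.eventually_ge_atTop {q x}] with S hS
    exact AddSubgroup.subset_closure (by simpa using hS)
  let C := Filter.Germ (Filter.atTop : Filter (Finset (W ⧸ Bb))) (A ⧸ N)
  have hC : IsNil2 C :=
    IsNil2.germ _ (hA.of_surjective _ (QuotientGroup.mk'_surjective N))
  let f : A →* C := MonoidHom.mk'
    (fun x => (((fun _ => (x : A ⧸ N)) : Finset (W ⧸ Bb) → A ⧸ N) : C)) (fun x y => rfl)
  let g : A →* C := MonoidHom.mk' (fun x => ((ρ x : _ → A ⧸ N) : C)) (by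
    intro x y
    rw [← Filter.Germ.coe_mul, Filter.Germ.coe_eq]
    filter_upwards [hev x, hev y] with S hx hy
    have hxy : q (x * y) ∈ AddSubgroup.closure (S : Set (W ⧸ Bb)) := by
      rw [qmul]; exact add_mem hx hy
    simp only [ρ, Pi.mul_apply, dif_pos hx, dif_pos hy, dif_pos hxy]
    rw [← QuotientGroup.mk_mul]
    have e1 := hτ _ (hmem x S hx)
    have e2 := hτ _ (hmem y S hy)
    have e3 := hτ _ (hmem (x * y) S hxy)
    refine mkeq _ e3.1 _ (B.mul_mem e1.1 e2.1) ?_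
    rw [e3.2, πmul, πmul, e1.2, e2.2]
    have : (⟨q (x * y), hxy⟩ : AddSubgroup.closure (S : Set (W ⧸ Bb))) =
      ⟨q x, hx⟩ + ⟨q y, hy⟩ := Subtype.ext (qmul x y)
    rw [this, map_add]
    abel)
  have key : f a = g a := by
    refine ha C hC f g fun b hb => ?_
    refine Filter.Germ.coe_eq.2 ?_
    filter_upwards [hev b] with S hS
    simp only [ρ, dif_pos hS]
    have e1 := hτ _ (hmem b S hS)
    refine mkeq _ hb _ e1.1 ?_
    rw [e1.2]
    have hq : q b = 0 := (QuotientAddGroup.eq_zero_iff _).2 ((memBb _).2 ⟨b, hb, rfl⟩)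
    have : (⟨q b, hS⟩ : AddSubgroup.closure (S : Set (W ⧸ Bb))) = 0 := Subtype.ext hq
    rw [this, map_zero, sub_zero]
  have key' : (fun _ => (a : A ⧸ N)) =ᶠ[Filter.atTop] ρ a := Filter.Germ.coe_eq.1 key
  obtain ⟨S, h1, h2⟩ := (key'.and (hev a)).exists
  simp only [ρ, dif_pos h2] at h1
  have e1 := hτ _ (hmem a S h2)
  have h3 := (QuotientGroup.eq.1 h1).1
  have : a⁻¹ ∈ B := (B.mul_mem_cancel_right e1.1).1 h3
  exact B.inv_mem_iff.1 this

/-- If in a nil-2 group `G` every element, for every `n > 0`, either has an `n`-th root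
modulo the commutator subgroup, or has no `n`-th root in any nil-2 overgroup of `G`,
then `G` is absolutely closed in `N₂`. -/
theorem absolutelyClosed_of_roots_dichotomy {G : Type u} [Group G] (hG : IsNil2 G)
    (h : ∀ (x : G) (n : ℕ), 0 < n →
      (∃ r r' : G, r' ∈ commutator G ∧ x = r ^ n * r') ∨
      (∀ (K : Type u) [Group K], IsNil2 K → ∀ ι : G →* K, Function.Injective ι →
        ∀ k : K, k ^ n ≠ ι x)) :
    IsAbsolutelyClosed G := by
  intro A _ hA ι hι
  apply dominion_of_pure hA
  rintro x n hn _ ⟨b, rfl⟩ c hc hx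
  rcases h b n hn with ⟨r, r', hr', hb⟩ | hno
  · refine ⟨ι r, ⟨r, rfl⟩, ι r' * c, ?_, ?_⟩
    · refine mul_mem ?_ hc
      have h1 : commutator G ≤ (commutator A).comap ι := by
        rw [commutator_def, Subgroup.commutator_le]
        intro u _ v _
        rw [Subgroup.mem_comap, map_commutatorElement]
        exact Subgroup.commutator_mem_commutator trivial trivial
      exact h1 hr'
    · rw [hx, hb]; simp [mul_assoc]
  · exfalso
    obtain ⟨K, _, j, d, hK, hj, hd, hdn⟩ := exists_overgroup hA c (hA hc) n hn
    refine hno K hK (j.comp ι) (hj.comp hι) (j x * d⁻¹) ?_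
    have hcomm : Commute (j x) d⁻¹ := (Commute.inv_right (hd (j x)).symm)
    rw [hcomm.mul_pow, ← map_pow, hx, inv_pow, hdn]
    simp
end

section
/- If G is a divisible group of nilpotency class at most 2 (that is, for every g ∈ G and every integer n > 0 there exists h ∈ G with h^n = g), then G is absolutely closed in N₂. -/
universe u

/-- A divisible abelian subgroup is a retract. -/
theorem exists_retraction_of_divisible {X : Type u} [CommGroup X] (D : Subgroup X)
    (hD : ∀ (d : D) (n : ℕ), 0 < n → ∃ e : D, e ^ n = d) :
    ∃ s : X →* D, ∀ d : D, s d = d := by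
  have hsm : ∀ {n : ℤ}, n ≠ 0 → Function.Surjective (fun a : Additive D => n • a) := by
    intro n hn d
    obtain ⟨e, he⟩ := hD d.toMul n.natAbs (Int.natAbs_pos.mpr hn)
    rcases Int.natAbs_eq n with h | h
    · refine ⟨Additive.ofMul e, ?_⟩
      change n • Additive.ofMul e = d
      rw [h, natCast_zsmul, ← ofMul_pow, he]; rfl
    · refine ⟨-Additive.ofMul e, ?_⟩
      change n • (-Additive.ofMul e) = d
      rw [h, neg_smul, smul_neg, neg_neg, natCast_zsmul, ← ofMul_pow, he]; rfl
  let _ : DivisibleBy (Additive D) ℤ := divisibleByOfSMulRightSurj _ _ hsm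
  have hB : Module.Baer ℤ (Additive D) := Module.Baer.of_divisible _
  obtain ⟨h, hh⟩ := hB.extension_property_addMonoidHom (MonoidHom.toAdditive D.subtype)
    (fun x y hxy => by exact Subtype.ext hxy) (AddMonoidHom.id _)
  exact ⟨MonoidHom.toAdditive.symm h, fun d => DFunLike.congr_fun hh (Additive.ofMul d)⟩

/-- A divisible nil-2 group is absolutely closed in `N₂`. -/
theorem absolutelyClosed_of_divisible {G : Type u} [Group G] (hG : IsNil2 G)
    (hdiv : ∀ (g : G) (n : ℕ), 0 < n → ∃ h : G, h ^ n = g) :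
    IsAbsolutelyClosed G := by
  intro A _ hA ι hι
  apply Set.Subset.antisymm
  swap
  · intro a ha C _ _ f g hfg
    exact hfg a ha
  intro a ha
  -- quotient by the central subgroup `N = ι(G) ∩ [A,A]`
  let N : Subgroup A := ι.range ⊓ commutator A
  have hN : N.Normal := by
    constructor
    intro n hn g
    have := Subgroup.mem_center_iff.mp (hA hn.2) g
    rw [this, mul_inv_cancel_right]
    exact hn
  have hQ : IsNil2 (A ⧸ N) := by
    unfold IsNil2
    rw [commutator_def, Subgroup.commutator_le]
    intro x _ y _
    induction x using QuotientGroup.induction_on with | _ x => ?_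
    induction y using QuotientGroup.induction_on with | _ y => ?_
    rw [Subgroup.mem_center_iff]
    intro z
    induction z using QuotientGroup.induction_on with | _ z => ?_
    have h1 : x * y * x⁻¹ * y⁻¹ ∈ commutator A :=
      Subgroup.commutator_mem_commutator (Subgroup.mem_top x) (Subgroup.mem_top y)
    have := Subgroup.mem_center_iff.mp (hA h1) z
    exact congrArg (QuotientGroup.mk (s := N)) this
  let φ : G →* Abelianization A := Abelianization.of.comp ι
  obtain ⟨s, hs⟩ := exists_retraction_of_divisible φ.range (by
    rintro ⟨_, g, rfl⟩ n hn
    obtain ⟨h, rfl⟩ := hdiv g n hn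
    exact ⟨⟨φ h, h, rfl⟩, Subtype.ext (by simp)⟩)
  have hker : φ.rangeRestrict.ker ≤ ((QuotientGroup.mk' N).comp ι).ker := by
    intro x hx
    rw [MonoidHom.ker_rangeRestrict, MonoidHom.mem_ker] at hx
    rw [MonoidHom.mem_ker]
    refine (QuotientGroup.eq_one_iff _).mpr ⟨⟨x, rfl⟩, ?_⟩
    rw [← Abelianization.ker_of]
    exact hx
  let j : φ.range →* A ⧸ N :=
    φ.rangeRestrict.liftOfSurjective φ.rangeRestrict_surjective
      ⟨(QuotientGroup.mk' N).comp ι, hker⟩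
  have hj : ∀ x : G, j (φ.rangeRestrict x) = QuotientGroup.mk' N (ι x) := fun x =>
    MonoidHom.liftOfRightInverse_comp_apply _ _ _ ⟨(QuotientGroup.mk' N).comp ι, hker⟩ x
  have key := ha (A ⧸ N) hQ (QuotientGroup.mk' N) ((j.comp s).comp Abelianization.of) (by
    rintro _ ⟨x, rfl⟩
    rw [← hj]
    exact congrArg j (hs (φ.rangeRestrict x)).symm)
  obtain ⟨x, hx⟩ := φ.rangeRestrict_surjective (s (Abelianization.of a))
  have h2 : QuotientGroup.mk' N (ι x) = QuotientGroup.mk' N a := by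
    rw [key, ← hj, hx]; rfl
  have h3 : (ι x)⁻¹ * a ∈ N := QuotientGroup.eq.mp h2
  have h4 := ι.range.mul_mem ⟨x, rfl⟩ h3.1
  rwa [mul_inv_cancel_left] at h4
end

section
/- Let π be a set of primes and let A and B be groups of nilpotency class at most 2. Suppose A is π-divisible (every element of A has a p-th root in A for every prime p ∈ π) and B is π'-divisible (every element of B has a q-th root in B for every prime q ∉ π). Then the direct product A × B is absolutely closed in N₂ if and only if both A and B are absolutely closed in N₂. -/
universe u

theorem fin_case {ι Z : Type*} [Finite ι] [AddCommGroup Z] (H : AddSubgroup (ι → ℤ))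
    (ω : (ι → ℤ) →+ (ι → ℤ) →+ Z) (halt : ∀ x, ω x x = 0)
    (hq : ∀ (q : ℤ) x y, q • x ∈ H → q • y ∈ H → q • ω x y = 0) :
    ∃ β : (ι → ℤ) →+ (ι → ℤ) →+ Z, (∀ x, ∀ h ∈ H, β x h = 0) ∧
      ∀ x y, β x y - β y x = ω x y := by
  classical
  have := Fintype.ofFinite ι
  obtain ⟨n, ⟨bM, bN, f, a, snf⟩⟩ :=
    Submodule.smithNormalForm (Pi.basisFun ℤ ι) (AddSubgroup.toIntSubmodule H)
  -- elementary divisors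
  obtain ⟨d, hd, hdH⟩ : ∃ d : ι → ℤ, (∀ i, d i • bM i ∈ H) ∧
      (∀ (φ : (ι → ℤ) →+ Z), (∀ i, d i • φ (bM i) = 0) → ∀ h ∈ H, φ h = 0) := by
    refine ⟨fun i => if h : ∃ k, f k = i then a h.choose else 0, ?_, ?_⟩
    · intro i
      by_cases h : ∃ k, f k = i
      · simp only [h, dif_pos]
        have := snf h.choose
        rw [h.choose_spec] at this
        rw [← this]
        exact (bN h.choose).2
      · simp only [h, dif_neg, not_false_eq_true, zero_smul]
        exact H.zero_mem
    · intro φ hφ h hh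
      have h1 : (AddMonoidHom.toIntLinearMap φ).comp (AddSubgroup.toIntSubmodule H).subtype = 0 := by
        apply bN.ext
        intro k
        have h2 := hφ (f k)
        have h3 : ∃ k', f k' = f k := ⟨k, rfl⟩
        have h4 : h3.choose = k := f.injective h3.choose_spec
        beta_reduce at h2
        rw [dif_pos h3, h4] at h2
        simp only [LinearMap.comp_apply, Submodule.subtype_apply, snf, LinearMap.zero_apply,
          AddMonoidHom.coe_toIntLinearMap, map_zsmul, h2]
      exact LinearMap.congr_fun h1 ⟨h, hh⟩
  have hanti : ∀ x y, ω x y = - ω y x := by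
    intro x y
    have := halt (x + y)
    simp only [map_add, AddMonoidHom.add_apply, halt, zero_add, add_zero] at this
    exact eq_neg_of_add_eq_zero_right this
  have key : ∀ i j, ∃ s : ℤ, (d j * s) • ω (bM i) (bM j) = 0 ∧
      (d i * (1 - s)) • ω (bM i) (bM j) = 0 := by
    intro i j
    by_cases h0 : d i = 0
    · exact ⟨0, by simp, by simp [h0]⟩
    obtain ⟨g, a, b, h1, h2, h3⟩ : ∃ g a b : ℤ, d i = g * a ∧ d j = g * b ∧ IsCoprime a b := by
      obtain ⟨x, hx⟩ := Int.gcd_dvd_left (d i) (d j)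
      obtain ⟨y, hy⟩ := Int.gcd_dvd_right (d i) (d j)
      refine ⟨Int.gcd (d i) (d j), x, y, hx, hy, ?_⟩
      have hg : (Int.gcd (d i) (d j) : ℤ) ≠ 0 := by
        intro h; rw [h] at hx; simp at hx; exact h0 hx
      have hb := Int.gcd_eq_gcd_ab (d i) (d j)
      refine ⟨Int.gcdA (d i) (d j), Int.gcdB (d i) (d j), ?_⟩
      apply mul_left_cancel₀ hg
      linear_combination (-Int.gcdA (d i) (d j)) * hx - Int.gcdB (d i) (d j) * hy - hb
    obtain ⟨s, t, hst⟩ := h3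
    have hl : (g * a * b) • ω (bM i) (bM j) = 0 := by
      apply hq
      · rw [← h1, mul_comm, mul_smul]; exact H.zsmul_mem (hd i) _
      · rw [show g * a * b = a * d j by rw [h2]; ring, mul_smul]; exact H.zsmul_mem (hd j) _
    refine ⟨s * a, ?_, ?_⟩
    · rw [show d j * (s * a) = s * (g * a * b) by rw [h2]; ring, mul_smul, hl, smul_zero]
    · rw [show d i * (1 - s * a) = t * (g * a * b) by rw [h1, ← hst]; ring, mul_smul, hl, smul_zero]
  choose s hs1 hs2 using key
  obtain ⟨r, hr⟩ : ∃ r : ι → ι → Prop, ∀ i j, i ≠ j → (r i j ↔ ¬ r j i) := by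
    refine ⟨fun i j => WellOrderingRel i j, fun i j hij => ⟨fun h => asymm h, fun h => ?_⟩⟩
    rcases trichotomous_of WellOrderingRel i j with h1 | h1 | h1
    · exact h1
    · exact absurd h1 hij
    · exact absurd h1 h
  let σ : ι → ι → ℤ := fun i j => if r i j then s i j else 1 - s j i
  have hσ : ∀ i j, d j • (σ i j • ω (bM i) (bM j)) = 0 := by
    intro i j
    simp only [σ, smul_smul]
    split_ifs
    · exact hs1 i j
    · rw [hanti, smul_neg, hs2 j i, neg_zero]
  have hσ' : ∀ i j, i ≠ j → σ i j + σ j i = 1 := by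
    intro i j hij
    have := hr i j hij
    simp only [σ]
    by_cases h : r i j
    · simp [h, this.1 h]
    · have : r j i := by tauto
      simp [h, this]
  let βl : (ι → ℤ) →ₗ[ℤ] (ι → ℤ) →ₗ[ℤ] Z :=
    bM.constr ℤ fun i => bM.constr ℤ fun j => σ i j • ω (bM i) (bM j)
  have hβ : ∀ i j, βl (bM i) (bM j) = σ i j • ω (bM i) (bM j) := by
    intro i j; simp [βl]
  refine ⟨AddMonoidHom.mk' (fun x => (βl x).toAddMonoidHom) ?_, ?_, ?_⟩
  · intro x y; ext; simp
  · intro x h hh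
    have : βl.flip h = 0 := by
      apply bM.ext; intro i
      refine hdH (βl (bM i)).toAddMonoidHom (fun j => ?_) h hh
      exact (congrArg (d j • ·) (hβ i j)).trans (hσ i j)
    exact LinearMap.congr_fun this x
  · intro x y
    have : βl - βl.flip = (AddMonoidHom.toIntLinearMap (AddMonoidHom.mk' (fun x => AddMonoidHom.toIntLinearMap (ω x)) (by intro x y; ext; simp))) := by
      apply bM.ext; intro i; apply bM.ext; intro j
      simp only [LinearMap.sub_apply, LinearMap.flip_apply, hβ, AddMonoidHom.coe_toIntLinearMap, AddMonoidHom.mk'_apply]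
      by_cases hij : i = j
      · subst hij; simp [halt]
      · rw [hanti (bM j) (bM i), smul_neg, sub_neg_eq_add, ← add_smul, hσ' i j hij, one_smul]
    exact LinearMap.congr_fun (LinearMap.congr_fun this x) y


theorem compact_case {V Z : Type*} [AddCommGroup V] [AddCommGroup Z] [TopologicalSpace Z]
    [CompactSpace Z] [T2Space Z] [IsTopologicalAddGroup Z] (H : AddSubgroup V)
    (ω : V →+ V →+ Z) (halt : ∀ x, ω x x = 0)
    (hq : ∀ (q : ℤ) x y, q • x ∈ H → q • y ∈ H → q • ω x y = 0) :
    ∃ β : V →+ V →+ Z, (∀ x, ∀ h ∈ H, β x h = 0) ∧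
      ∀ x y, β x y - β y x = ω x y := by
  classical
  let T : Finset V → Set (V → V → Z) := fun S =>
    {β | ∀ x ∈ S, ∀ y ∈ S, ∀ z ∈ S, β (x + y) z = β x z + β y z ∧ β z (x + y) = β z x + β z y ∧
      (x ∈ H → β z x = 0) ∧ β x y - β y x = ω x y}
  have hcl : ∀ S, IsClosed (T S) := by
    intro S
    have hc : ∀ x y : V, Continuous fun β : V → V → Z => β x y := fun x y => by fun_prop
    simp only [T, Set.ofPred_forall, Set.ofPred_and]
    refine isClosed_iInter fun x => isClosed_iInter fun _ => isClosed_iInter fun y =>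
      isClosed_iInter fun _ => isClosed_iInter fun z => isClosed_iInter fun _ => ?_
    refine (isClosed_eq (hc _ _) ((hc _ _).add (hc _ _))).inter
      ((isClosed_eq (hc _ _) ((hc _ _).add (hc _ _))).inter (IsClosed.inter ?_
        (isClosed_eq ((hc _ _).sub (hc _ _)) continuous_const)))
    exact isClosed_iInter fun _ => isClosed_eq (hc _ _) continuous_const
  have hne : ∀ S, (T S).Nonempty := by
    intro S
    let p : (S → ℤ) →+ V :=
      AddMonoidHom.mk' (fun e => ∑ s : S, e s • (s : V)) (by
        intro a b; simp [add_smul, Finset.sum_add_distrib])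
    let ω' : (S → ℤ) →+ (S → ℤ) →+ Z := AddMonoidHom.mk' (fun x => (ω (p x)).comp p) (by
      intro x y; ext; simp)
    have hω' : ∀ x y, ω' x y = ω (p x) (p y) := fun x y => rfl
    obtain ⟨β, h1, h2⟩ := fin_case (H.comap p) ω' (fun x => halt _) (by
      intro q x y hx hy
      rw [hω']
      refine hq q _ _ ?_ ?_
      · rw [← map_zsmul]; exact hx
      · rw [← map_zsmul]; exact hy)
    have hr1 : ∀ x y r, p r = 0 → β x r = 0 ∧ β r y = 0 := by
      intro x y r hr
      have : ∀ x, β x r = 0 := fun x => h1 x r (by simp [AddSubgroup.mem_comap, hr])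
      refine ⟨this x, ?_⟩
      have h3 := h2 r y
      rw [this, hω', hr] at h3
      simpa using h3
    have hw : ∀ x x' y y', p x = p x' → p y = p y' → β x y = β x' y' := by
      intro x x' y y' hx hy
      have e1 := (hr1 x 0 (y - y') (by simp [hy])).1
      have e2 := (hr1 0 y' (x - x') (by simp [hx])).2
      rw [map_sub, sub_eq_zero] at e1
      rw [map_sub, AddMonoidHom.sub_apply, sub_eq_zero] at e2
      rw [e1, e2]
    let σ : V → (S → ℤ) := Function.invFun p
    have hσ : ∀ e, p (σ (p e)) = p e := fun e => Function.invFun_eq ⟨e, rfl⟩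
    have hS : ∀ x ∈ S, ∃ e, p e = x := by
      intro x hx
      refine ⟨Pi.single ⟨x, hx⟩ 1, ?_⟩
      simp [p, Pi.single_apply, ite_smul]
    refine ⟨fun x y => β (σ x) (σ y), ?_⟩
    intro x hx y hy z hz
    obtain ⟨x, rfl⟩ := hS x hx
    obtain ⟨y, rfl⟩ := hS y hy
    obtain ⟨z, rfl⟩ := hS z hz
    rw [← map_add]
    have hb : ∀ x y, β (σ (p x)) (σ (p y)) = β x y := fun x y => hw _ _ _ _ (hσ x) (hσ y)
    simp only [hb]
    refine ⟨by simp, by simp, fun h => h1 _ _ h, h2 x y⟩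
  have hdir : Directed (fun x1 x2 => x1 ⊇ x2) T := by
    intro S S'
    refine ⟨S ∪ S', ?_, ?_⟩
    · intro β hβ x hx y hy z hz
      exact hβ x (Finset.mem_union_left _ hx) y (Finset.mem_union_left _ hy) z (Finset.mem_union_left _ hz)
    · intro β hβ x hx y hy z hz
      exact hβ x (Finset.mem_union_right _ hx) y (Finset.mem_union_right _ hy) z (Finset.mem_union_right _ hz)
  obtain ⟨β, hβ⟩ := IsCompact.nonempty_iInter_of_directed_nonempty_isCompact_isClosed T hdir hne
    (fun S => (hcl S).isCompact) hcl
  have hβ' : ∀ x y z, β (x + y) z = β x z + β y z ∧ β z (x + y) = β z x + β z y ∧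
      (x ∈ H → β z x = 0) ∧ β x y - β y x = ω x y := by
    intro x y z
    exact Set.mem_iInter.1 hβ {x, y, z} x (by simp) y (by simp) z (by simp)
  refine ⟨AddMonoidHom.mk' (fun x => AddMonoidHom.mk' (β x) fun y z => (hβ' y z x).2.1) ?_, ?_, ?_⟩
  · intro x y; ext z; exact (hβ' x y z).1
  · intro x h hh; exact (hβ' h h x).2.2.1 hh
  · intro x y; exact (hβ' x y x).2.2.2

theorem exists_char {V : Type*} [AddCommGroup V] (N : AddSubgroup V) (c : V) (hc : c ∉ N) :
    ∃ χ : V →+ AddCircle (1 : ℝ), (∀ n ∈ N, χ n = 0) ∧ χ c ≠ 0 := by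
  have h0 : (QuotientAddGroup.mk' N c) ≠ 0 := by
    simpa [QuotientAddGroup.eq_zero_iff] using hc
  obtain ⟨χ, hχ⟩ := CharacterModule.exists_character_apply_ne_zero_of_ne_zero h0
  let m : AddCircle (1 : ℚ) →+ AddCircle (1 : ℝ) :=
    QuotientAddGroup.map _ _ (Rat.castHom ℝ).toAddMonoidHom (by
      rintro _ ⟨n, rfl⟩
      exact ⟨n, by simp⟩)
  have hm : ∀ a, m a = 0 → a = 0 := by
    intro a
    induction a using QuotientAddGroup.induction_on with
    | H q =>
      intro h
      have h' : (((q : ℚ) : ℝ) : AddCircle (1 : ℝ)) = 0 := h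
      rw [AddCircle.coe_eq_zero_iff] at h'
      obtain ⟨n, hn⟩ := h'
      refine (AddCircle.coe_eq_zero_iff (1 : ℚ)).2 ⟨n, ?_⟩
      simp only [zsmul_eq_mul, mul_one] at hn ⊢
      exact_mod_cast hn
  let χ' : (V ⧸ N) →+ AddCircle (1 : ℚ) := χ
  refine ⟨m.comp (χ'.comp (QuotientAddGroup.mk' N)), ?_, ?_⟩
  · intro n hn
    have : QuotientAddGroup.mk' N n = 0 := (QuotientAddGroup.eq_zero_iff n).2 hn
    simp only [AddMonoidHom.comp_apply, this, map_zero]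
  · intro h
    exact hχ (hm _ h)

open scoped commutatorElement

namespace Nil2

/-- The additive abelianization. -/
abbrev Ab (K : Type*) [Group K] := Additive (Abelianization K)

/-- The class of an element in the additive abelianization. -/
def ab {K : Type*} [Group K] (k : K) : Ab K := Additive.ofMul (Abelianization.of k)

section basics
variable {K : Type*} [Group K]

theorem ab_mul (x y : K) : ab (x * y) = ab x + ab y := by simp [ab]
theorem ab_one : ab (1 : K) = 0 := by simp [ab]
theorem ab_inv (x : K) : ab (x⁻¹) = - ab x := by simp [ab]
theorem ab_pow (x : K) (n : ℕ) : ab (x ^ n) = n • ab x := by simp [ab]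
theorem ab_eq_zero (x : K) : ab x = 0 ↔ x ∈ commutator K := by
  rw [← Abelianization.ker_of, MonoidHom.mem_ker]; exact Iff.rfl
theorem ab_surj (v : Ab K) : ∃ x : K, ab x = v := by
  obtain ⟨x, hx⟩ := QuotientGroup.mk'_surjective (commutator K) (Additive.toMul v)
  exact ⟨x, hx⟩
theorem ab_comm (x y : K) : ab ⁅x, y⁆ = 0 := by
  rw [commutatorElement_def]; simp only [ab_mul, ab_inv]; abel

theorem comm_mem (x y : K) : ⁅x, y⁆ ∈ commutator K :=
  Subgroup.commutator_mem_commutator (Subgroup.mem_top _) (Subgroup.mem_top _)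

theorem isNil2_of (h : ∀ x y : K, ⁅x, y⁆ ∈ Subgroup.center K) : IsNil2 K := by
  unfold IsNil2
  rw [commutator_def, Subgroup.commutator_le]
  intro x _ y _
  exact h x y

variable (hK : IsNil2 K)
include hK

theorem comm_center (x y : K) : ⁅x, y⁆ ∈ Subgroup.center K := hK (comm_mem x y)

theorem comm_mul_left (x y z : K) : ⁅x * y, z⁆ = ⁅x, z⁆ * ⁅y, z⁆ := by
  have h := Subgroup.mem_center_iff.1 (comm_center hK y z)
  have : ⁅x * y, z⁆ = x * ⁅y, z⁆ * z * x⁻¹ * z⁻¹ := by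
    simp only [commutatorElement_def]; group
  rw [this, h x, mul_assoc, mul_assoc, mul_assoc, ← h, commutatorElement_def x z]
  group

theorem comm_mul_right (x y z : K) : ⁅z, x * y⁆ = ⁅z, x⁆ * ⁅z, y⁆ := by
  rw [← commutatorElement_inv, comm_mul_left hK, mul_inv_rev, commutatorElement_inv,
    commutatorElement_inv]
  exact (Subgroup.mem_center_iff.1 (comm_center hK z y) _).symm

theorem comm_pow_left (x y : K) (n : ℕ) : ⁅x ^ n, y⁆ = ⁅x, y⁆ ^ n := by
  induction n with
  | zero => simp
  | succ n ih => rw [pow_succ, pow_succ, comm_mul_left hK, ih]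

theorem comm_pow_right (x y : K) (n : ℕ) : ⁅x, y ^ n⁆ = ⁅x, y⁆ ^ n := by
  induction n with
  | zero => simp
  | succ n ih => rw [pow_succ, pow_succ, comm_mul_right hK, ih]

theorem comm_central_left (c y : K) (hc : c ∈ Subgroup.center K) : ⁅c, y⁆ = 1 := by
  rw [commutatorElement_eq_one_iff_mul_comm]
  exact (Subgroup.mem_center_iff.1 hc y).symm

theorem comm_congr_left {x x' : K} (y : K) (h : ab x = ab x') : ⁅x, y⁆ = ⁅x', y⁆ := by
  have h1 : x * x'⁻¹ ∈ commutator K := by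
    rw [← ab_eq_zero, ab_mul, ab_inv, h]; abel
  have h2 : x = x * x'⁻¹ * x' := by group
  rw [h2, comm_mul_left hK, comm_central_left hK _ _ (hK h1), one_mul]

theorem comm_congr {x x' y y' : K} (h : ab x = ab x') (h' : ab y = ab y') :
    ⁅x, y⁆ = ⁅x', y'⁆ := by
  rw [comm_congr_left hK y h, ← commutatorElement_inv, comm_congr_left hK x' h',
    commutatorElement_inv]

end basics

/-- Central extension of `K` by `Z` with bilinear cocycle. -/
structure Ext {K Z : Type*} [Group K] [AddCommGroup Z] (β : Ab K →+ Ab K →+ Z) where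
  k : K
  z : Z

namespace Ext
variable {K Z : Type*} [Group K] [AddCommGroup Z] {β : Ab K →+ Ab K →+ Z}

theorem ext' {x y : Ext β} (h : x.k = y.k) (h' : x.z = y.z) : x = y := by
  cases x; cases y; simp_all

instance : Mul (Ext β) := ⟨fun x y => ⟨x.k * y.k, x.z + y.z + β (ab x.k) (ab y.k)⟩⟩
instance : One (Ext β) := ⟨⟨1, 0⟩⟩
instance : Inv (Ext β) := ⟨fun x => ⟨x.k⁻¹, -x.z + β (ab x.k) (ab x.k)⟩⟩
theorem mul_k (x y : Ext β) : (x * y).k = x.k * y.k := rfl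
theorem mul_z (x y : Ext β) : (x * y).z = x.z + y.z + β (ab x.k) (ab y.k) := rfl
theorem one_k : (1 : Ext β).k = 1 := rfl
theorem one_z : (1 : Ext β).z = 0 := rfl
theorem inv_k (x : Ext β) : (x⁻¹).k = x.k⁻¹ := rfl
theorem inv_z (x : Ext β) : (x⁻¹).z = -x.z + β (ab x.k) (ab x.k) := rfl

instance : Group (Ext β) := Group.ofLeftAxioms
  (by
    intro x y z
    apply ext'
    · simp only [mul_k, mul_assoc]
    · simp only [mul_k, mul_z, ab_mul, map_add, AddMonoidHom.add_apply]; abel)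
  (by
    intro x
    apply ext'
    · simp only [mul_k, one_k, one_mul]
    · simp only [mul_z, one_k, one_z, ab_one, map_zero, AddMonoidHom.zero_apply]; abel)
  (by
    intro x
    apply ext'
    · simp only [mul_k, inv_k, one_k, inv_mul_cancel]
    · simp only [mul_z, inv_k, inv_z, one_z, ab_inv, map_neg, AddMonoidHom.neg_apply]; abel)

theorem comm_eq (x y : Ext β) :
    ⁅x, y⁆ = ⟨⁅x.k, y.k⁆, β (ab x.k) (ab y.k) - β (ab y.k) (ab x.k)⟩ := by
  rw [commutatorElement_def, mul_inv_eq_iff_eq_mul, mul_inv_eq_iff_eq_mul]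
  apply ext'
  · simp only [mul_k, commutatorElement_def]; group
  · simp only [mul_k, mul_z, ab_comm, ab_mul, map_zero, AddMonoidHom.zero_apply, zero_add,
      map_add, AddMonoidHom.add_apply]; abel

end Ext

/-- The target group: a semidirect product of `K` with `Hom (K, Z) × W`. -/
structure Tgt {Z W : Type*} (K : Type*) [Group K] [AddCommGroup Z] [CommGroup W]
    (i : Multiplicative Z →* W) where
  k : K
  φ : Ab K →+ Z
  w : W

namespace Tgt
variable {K Z W : Type*} [Group K] [AddCommGroup Z] [CommGroup W] {i : Multiplicative Z →* W}

theorem ext' {x y : Tgt K i} (h : x.k = y.k) (h' : x.φ = y.φ) (h'' : x.w = y.w) : x = y := by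
  cases x; cases y; simp_all

instance : Mul (Tgt K i) :=
  ⟨fun x y => ⟨x.k * y.k, x.φ + y.φ, x.w * y.w * i (Multiplicative.ofAdd (y.φ (ab x.k)))⟩⟩
instance : One (Tgt K i) := ⟨⟨1, 0, 1⟩⟩
instance : Inv (Tgt K i) :=
  ⟨fun x => ⟨x.k⁻¹, -x.φ, x.w⁻¹ * i (Multiplicative.ofAdd (x.φ (ab x.k)))⟩⟩
theorem mul_k (x y : Tgt K i) : (x * y).k = x.k * y.k := rfl
theorem mul_φ (x y : Tgt K i) : (x * y).φ = x.φ + y.φ := rfl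
theorem mul_w (x y : Tgt K i) :
    (x * y).w = x.w * y.w * i (Multiplicative.ofAdd (y.φ (ab x.k))) := rfl
theorem one_k : (1 : Tgt K i).k = 1 := rfl
theorem one_φ : (1 : Tgt K i).φ = 0 := rfl
theorem one_w : (1 : Tgt K i).w = 1 := rfl
theorem inv_k (x : Tgt K i) : (x⁻¹).k = x.k⁻¹ := rfl
theorem inv_φ (x : Tgt K i) : (x⁻¹).φ = -x.φ := rfl
theorem inv_w (x : Tgt K i) :
    (x⁻¹).w = x.w⁻¹ * i (Multiplicative.ofAdd (x.φ (ab x.k))) := rfl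

instance : Group (Tgt K i) := Group.ofLeftAxioms
  (by
    intro x y z
    apply ext'
    · simp only [mul_k, mul_assoc]
    · simp only [mul_φ, add_assoc]
    · simp only [mul_k, mul_φ, mul_w, ab_mul, map_add, AddMonoidHom.add_apply, ofAdd_add, map_mul]
      simp only [mul_assoc, mul_left_comm, mul_comm])
  (by
    intro x
    apply ext'
    · simp only [mul_k, one_k, one_mul]
    · simp only [mul_φ, one_φ, zero_add]
    · simp only [mul_w, one_k, one_w, ab_one, map_zero, ofAdd_zero, map_one, one_mul, mul_one])
  (by
    intro x
    apply ext'
    · simp only [mul_k, inv_k, one_k, inv_mul_cancel]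
    · simp only [mul_φ, inv_φ, one_φ, neg_add_cancel]
    · simp only [mul_w, inv_k, inv_w, one_w, ab_inv, map_neg, ofAdd_neg, map_inv]
      rw [mul_right_comm _ _ x.w, inv_mul_cancel, one_mul, mul_inv_cancel])

theorem isNil2 (hK : IsNil2 K) : IsNil2 (Tgt K i) := by
  apply isNil2_of
  intro x y
  let p1 : Tgt K i →* K := MonoidHom.mk' (fun x => x.k) (fun _ _ => rfl)
  let p2 : Tgt K i →* Multiplicative (Ab K →+ Z) :=
    MonoidHom.mk' (fun x => Multiplicative.ofAdd x.φ) (fun _ _ => rfl)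
  have h1 : (⁅x, y⁆ : Tgt K i).k = ⁅x.k, y.k⁆ := map_commutatorElement p1 x y
  have h2 : (⁅x, y⁆ : Tgt K i).φ = 0 := by
    have : p2 ⁅x, y⁆ = 1 := by
      rw [map_commutatorElement, commutatorElement_eq_one_iff_mul_comm, mul_comm]
    exact this
  rw [Subgroup.mem_center_iff]
  intro g
  apply ext'
  · simp only [mul_k, h1]
    exact Subgroup.mem_center_iff.1 (comm_center hK _ _) _
  · simp only [mul_φ, add_comm]
  · simp only [mul_w, h1, h2, ab_comm, map_zero, AddMonoidHom.zero_apply, ofAdd_zero, map_one,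
      mul_one, mul_comm]

end Tgt

/-- The generators of the dominion. -/
def gens {K : Type*} [Group K] (H : Subgroup K) : Set K :=
  {g | ∃ (q : ℕ) (x y : K), 0 < q ∧ (∃ h ∈ H, ab h = q • ab x) ∧ (∃ h ∈ H, ab h = q • ab y) ∧
    g = ⁅x, y⁆ ^ q}

theorem dominion_le {K : Type u} [Group K] (hK : IsNil2 K) (H : Subgroup K) (d : K)
    (hd : d ∈ Dominion H) : d ∈ H ⊔ Subgroup.closure (gens H) := by
  -- Step 1
  have step1 : ∃ h ∈ H, Abelianization.of h = Abelianization.of d := by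
    let Q := Abelianization K ⧸ (H.map Abelianization.of)
    let f : K →* Q := (QuotientGroup.mk' (H.map Abelianization.of)).comp Abelianization.of
    have hQ : IsNil2 Q := isNil2_of fun x y => by
      rw [commutatorElement_eq_one_iff_mul_comm.2 (mul_comm x y)]; exact Subgroup.one_mem _
    have := hd Q hQ f 1 (by
      intro b hb
      exact (QuotientGroup.eq_one_iff _).2 ⟨b, hb, rfl⟩)
    exact (QuotientGroup.eq_one_iff _).1 this
  obtain ⟨h, hh, hhd⟩ := step1
  by_contra hcon
  have hc : h⁻¹ * d ∈ commutator K := by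
    rw [← ab_eq_zero, ab_mul, ab_inv]
    have : ab h = ab d := hhd
    rw [this]; abel
  set D := H ⊔ Subgroup.closure (gens H) with hD
  have hcD : h⁻¹ * d ∉ D := by
    intro hx
    apply hcon
    have := D.mul_mem ((le_sup_left : H ≤ D) hh) hx
    simpa using this
  letI : CommGroup (Subgroup.center K) :=
    { (inferInstance : Group (Subgroup.center K)) with
      mul_comm := fun a b => Subtype.ext (Subgroup.mem_center_iff.1 b.2 a) }
  obtain ⟨χ, hχ1, hχ2⟩ := exists_char (Subgroup.toAddSubgroup (D.subgroupOf (Subgroup.center K)))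
    (Additive.ofMul (⟨h⁻¹ * d, hK hc⟩ : Subgroup.center K)) (by simpa [Subgroup.mem_subgroupOf] using hcD)
  let Z := AddCircle (1 : ℝ)
  -- χ as function on the center
  let ξ : Subgroup.center K → Z := fun z => χ (Additive.ofMul z)
  have ξ_mul : ∀ a b, ξ (a * b) = ξ a + ξ b := fun a b => map_add χ _ _
  have ξ_inv : ∀ a, ξ (a⁻¹) = - ξ a := fun a => map_neg χ _
  have ξ_one : ξ 1 = 0 := map_zero χ
  have ξ_D : ∀ a : Subgroup.center K, (a : K) ∈ D → ξ a = 0 := fun a ha =>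
    hχ1 _ ha
  choose s hs using ab_surj (K := K)
  have hcmap : ∀ (x x' y y' : K), ab x = ab x' → ab y = ab y' →
      ξ ⟨⁅x, y⁆, comm_center hK x y⟩ = ξ ⟨⁅x', y'⁆, comm_center hK x' y'⟩ := by
    intro x x' y y' e1 e2
    congr 2
    exact comm_congr hK e1 e2
  let ω : Ab K →+ Ab K →+ Z := AddMonoidHom.mk' (fun u => AddMonoidHom.mk'
      (fun v => ξ ⟨⁅s u, s v⁆, comm_center hK _ _⟩) (by
        intro v v'
        rw [← ξ_mul, hcmap (s u) (s u) (s (v + v')) (s v * s v') rfl (by simp only [ab_mul, hs])]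
        congr 1
        exact Subtype.ext (comm_mul_right hK _ _ _))) (by
      intro u u'
      refine AddMonoidHom.ext fun v => ?_
      simp only [AddMonoidHom.mk'_apply, AddMonoidHom.add_apply]
      rw [← ξ_mul, hcmap (s (u + u')) (s u * s u') (s v) (s v) (by simp only [ab_mul, hs]) rfl]
      congr 1
      exact Subtype.ext (comm_mul_left hK _ _ _))
  have hω : ∀ x y : K, ω (ab x) (ab y) = ξ ⟨⁅x, y⁆, comm_center hK x y⟩ := fun x y =>
    hcmap _ _ _ _ (hs _) (hs _)
  let abH : K →* Abelianization K := Abelianization.of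
  let HA : AddSubgroup (Ab K) := Subgroup.toAddSubgroup (H.map Abelianization.of)
  have hHA : ∀ v, v ∈ HA ↔ ∃ h ∈ H, ab h = v := fun v => Iff.rfl
  obtain ⟨β, hβH, hβω⟩ := compact_case HA ω (by
      intro v
      obtain ⟨x, rfl⟩ := ab_surj v
      rw [hω]
      rw [← ξ_one]; congr 1; exact Subtype.ext (commutatorElement_self x)) (by
      have pos : ∀ (q : ℕ) x y, q • x ∈ HA → q • y ∈ HA → q • ω x y = 0 := by
        intro q x y hx hy
        rcases Nat.eq_zero_or_pos q with rfl | hq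
        · simp
        obtain ⟨x, rfl⟩ := ab_surj x
        obtain ⟨y, rfl⟩ := ab_surj y
        rw [← AddMonoidHom.map_nsmul, ← ab_pow, hω]
        apply ξ_D
        apply (le_sup_right : _ ≤ D)
        apply Subgroup.subset_closure
        exact ⟨q, x, y, hq, hx, hy, comm_pow_right hK x y q⟩
      intro q x y hx hy
      obtain ⟨n, rfl | rfl⟩ := q.eq_nat_or_neg
      · rw [natCast_zsmul] at *; exact pos n x y hx hy
      · rw [neg_smul, natCast_zsmul, neg_mem_iff] at hx hy
        rw [neg_smul, natCast_zsmul, pos n x y hx hy, neg_zero])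
  have hβH' : ∀ v, ∀ h ∈ H, β v (ab h) = 0 := fun v h hh => hβH v _ ⟨h, hh, rfl⟩
  have hβ0 : ∀ v, ∀ c ∈ commutator K, β v (ab c) = 0 := fun v c hc => by
    rw [(ab_eq_zero c).2 hc, map_zero]
  -- the subgroup Γ
  let Γ : Subgroup (Ext β) :=
    { carrier := {x | ∃ h ∈ H, ∃ (c : K) (hc : c ∈ commutator K), x = ⟨h * c, ξ ⟨c, hK hc⟩⟩}
      one_mem' := ⟨1, H.one_mem, 1, Subgroup.one_mem _, Ext.ext' (by simp [Ext.one_k])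
        (by rw [Ext.one_z]; exact ξ_one.symm)⟩
      mul_mem' := by
        rintro _ _ ⟨h, hh, c, hc, rfl⟩ ⟨h', hh', c', hc', rfl⟩
        refine ⟨h * h', H.mul_mem hh hh', c * c', Subgroup.mul_mem _ hc hc', Ext.ext' ?_ ?_⟩
        · simp only [Ext.mul_k]
          have := Subgroup.mem_center_iff.1 (hK hc) h'
          rw [mul_assoc, ← mul_assoc c, ← this]; group
        · simp only [Ext.mul_z, ab_mul, map_add, AddMonoidHom.add_apply, hβH' _ h' hh',
            hβ0 _ c' hc', add_zero]
          exact (ξ_mul ⟨c, hK hc⟩ ⟨c', hK hc'⟩).symm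
      inv_mem' := by
        rintro _ ⟨h, hh, c, hc, rfl⟩
        refine ⟨h⁻¹, H.inv_mem hh, c⁻¹, Subgroup.inv_mem _ hc, Ext.ext' ?_ ?_⟩
        · simp only [Ext.inv_k]
          have := Subgroup.mem_center_iff.1 (hK hc) h
          rw [this, mul_inv_rev]
        · simp only [Ext.inv_z, ab_mul, map_add, AddMonoidHom.add_apply, hβH' _ h hh,
            hβ0 _ c hc, add_zero]
          exact (ξ_inv ⟨c, hK hc⟩).symm }
  have hΓc : commutator (Ext β) ≤ Γ := by
    rw [commutator_def, Subgroup.commutator_le]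
    intro x _ y _
    refine ⟨1, H.one_mem, ⁅x.k, y.k⁆, comm_mem _ _, ?_⟩
    rw [Ext.comm_eq]
    exact Ext.ext' (by simp) (by rw [hβω, hω])
  let W := Abelianization (Ext β) ⧸ (Γ.map Abelianization.of)
  let qW : Ext β →* W := (QuotientGroup.mk' (Γ.map Abelianization.of)).comp Abelianization.of
  have hqΓ : ∀ x, qW x = 1 ↔ x ∈ Γ := by
    intro x
    constructor
    · intro hx
      obtain ⟨γ, hγ, e⟩ := (QuotientGroup.eq_one_iff _).1 hx
      have e' : ab γ = ab x := e
      have : γ⁻¹ * x ∈ commutator (Ext β) := by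
        rw [← ab_eq_zero, ab_mul, ab_inv, e']; abel
      have := Γ.mul_mem hγ (hΓc this)
      simpa using this
    · intro hx
      exact (QuotientGroup.eq_one_iff _).2 ⟨x, hx, rfl⟩
  let i : Multiplicative Z →* W := qW.comp (MonoidHom.mk' (fun z => ⟨1, Multiplicative.toAdd z⟩) (by
    intro a b
    apply Ext.ext'
    · simp [Ext.mul_k]
    · simp [Ext.mul_z, ab_one]))
  have hi : ∀ z : Z, i (Multiplicative.ofAdd z) = qW ⟨1, z⟩ := fun z => rfl
  let f : K →* Tgt K i := MonoidHom.mk' (fun k => ⟨k, 0, 1⟩) (by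
    intro a b
    apply Tgt.ext'
    · rfl
    · simp [Tgt.mul_φ]
    · simp [Tgt.mul_w])
  let g : K →* Tgt K i := MonoidHom.mk' (fun k => ⟨k, β.flip (ab k), (qW ⟨k, 0⟩)⁻¹⟩) (by
    intro a b
    apply Tgt.ext'
    · rfl
    · simp [Tgt.mul_φ, ab_mul]
    · simp only [Tgt.mul_w, AddMonoidHom.flip_apply, hi]
      have : (⟨a, 0⟩ : Ext β) * ⟨b, 0⟩ = ⟨a * b, 0⟩ * ⟨1, β (ab a) (ab b)⟩ := by
        apply Ext.ext'
        · simp [Ext.mul_k]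
        · simp [Ext.mul_z, ab_one]
      have := congrArg qW this
      rw [map_mul, map_mul] at this
      rw [← mul_inv, this, mul_inv, inv_mul_cancel_right])
  have hfg := hd (Tgt K i) (Tgt.isNil2 hK) f g (by
    intro b hb
    apply Tgt.ext'
    · rfl
    · refine AddMonoidHom.ext fun v => ?_
      exact (hβH' v b hb).symm
    · have : qW ⟨b, 0⟩ = 1 := (hqΓ _).2 ⟨b, hb, 1, Subgroup.one_mem _,
        Ext.ext' (by simp) ξ_one.symm⟩
      change 1 = (qW ⟨b, 0⟩)⁻¹
      rw [this, inv_one])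
  have hw : 1 = (qW ⟨d, 0⟩)⁻¹ := congrArg Tgt.w hfg
  have hdΓ : (⟨d, 0⟩ : Ext β) ∈ Γ := (hqΓ _).1 (by rw [← inv_inv (qW _), ← hw, inv_one])
  obtain ⟨h', hh', c', hc', e⟩ := hdΓ
  have e1 : d = h' * c' := congrArg Ext.k e
  have e2 : 0 = ξ ⟨c', hK hc'⟩ := congrArg Ext.z e
  have e3 : h⁻¹ * h' ∈ commutator K := by
    have : h⁻¹ * h' = h⁻¹ * d * c'⁻¹ := by rw [e1]; group
    rw [this]; exact Subgroup.mul_mem _ hc (Subgroup.inv_mem _ hc')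
  apply hχ2
  change ξ ⟨h⁻¹ * d, hK hc⟩ = 0
  have : (⟨h⁻¹ * d, hK hc⟩ : Subgroup.center K) = ⟨h⁻¹ * h', hK e3⟩ * ⟨c', hK hc'⟩ :=
    Subtype.ext (by simp [e1, mul_assoc])
  rw [this, ξ_mul, ← e2, add_zero]
  exact ξ_D _ ((le_sup_left : H ≤ D) (H.mul_mem (H.inv_mem hh) hh'))

/-- The easy half of the description of dominions. -/
theorem gens_dominion {K : Type u} [Group K] (H : Subgroup K) (q : ℕ) (x y : K)
    (hx : ∃ h ∈ H, ab h = q • ab x) (hy : ∃ h ∈ H, ab h = q • ab y) :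
    ⁅x, y⁆ ^ q ∈ Dominion H := by
  intro C _ hC f g hfg
  obtain ⟨h, hh, hx⟩ := hx
  obtain ⟨h', hh', hy⟩ := hy
  have nat : ∀ (f : K →* C) (a b : K), ab a = ab b → ab (f a) = ab (f b) := by
    intro f a b e
    exact congrArg (fun t => Additive.ofMul (Abelianization.map f t.toMul)) e
  rw [← ab_pow] at hx hy
  rw [map_pow, map_pow, map_commutatorElement, map_commutatorElement]
  have e1 : ab (f x ^ q) = ab (g x ^ q) := by
    rw [← map_pow, ← map_pow, ← nat f _ _ hx, ← nat g _ _ hx, hfg h hh]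
  have e2 : ab (f y ^ q) = ab (g y ^ q) := by
    rw [← map_pow, ← map_pow, ← nat f _ _ hy, ← nat g _ _ hy, hfg h' hh']
  rw [← comm_pow_left hC, comm_congr hC e1 rfl, comm_pow_left hC, ← comm_pow_right hC,
    comm_congr hC rfl e2, comm_pow_right hC]

theorem half {A K : Type u} [Group A] [Group K] (hK : IsNil2 K) (B : Subgroup K)
    (ι : A →* K) (hB : Dominion B = (B : Set K)) (hcomm : ∀ a, ∀ b ∈ B, ι a * b = b * ι a)
    (m : ℕ) (hroot : ∀ a : A, ∃ r, r ^ m = a)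
    (x y : K) (hx : ∃ a, ∃ b ∈ B, ab (ι a * b) = m • ab x)
    (hy : ∃ a, ∃ b ∈ B, ab (ι a * b) = m • ab y) :
    ∃ a, ∃ b ∈ B, ⁅x, y⁆ ^ m = ι a * b := by
  obtain ⟨a, b, hb, hx⟩ := hx
  obtain ⟨a', b', hb', hy⟩ := hy
  obtain ⟨r, rfl⟩ := hroot a
  obtain ⟨r', rfl⟩ := hroot a'
  set x' := (ι r)⁻¹ * x with hx'
  set y' := (ι r')⁻¹ * y with hy'
  have ex : x = ι r * x' := by simp [hx']
  have ey : y = ι r' * y' := by simp [hy']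
  have h1 : ab b = m • ab x' := by
    rw [hx', ab_mul, ab_inv, smul_add, ← hx, ab_mul, map_pow, ab_pow]; simp
  have h2 : ab b' = m • ab y' := by
    rw [hy', ab_mul, ab_inv, smul_add, ← hy, ab_mul, map_pow, ab_pow]; simp
  have h3 : ⁅x', y'⁆ ^ m ∈ B := by
    have := gens_dominion B m x' y' ⟨b, hb, h1⟩ ⟨b', hb', h2⟩
    rw [hB] at this
    exact this
  rw [← ab_pow] at h1 h2
  have h4 : ⁅x', ι r'⁆ ^ m = 1 := by
    rw [← comm_pow_left hK, ← comm_congr hK h1 rfl, commutatorElement_eq_one_iff_mul_comm]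
    exact (hcomm _ _ hb).symm
  have h5 : ⁅ι r, y'⁆ ^ m = 1 := by
    rw [← comm_pow_right hK, ← comm_congr hK rfl h2, commutatorElement_eq_one_iff_mul_comm]
    exact (hcomm _ _ hb')
  refine ⟨⁅r, r'⁆ ^ m, _, h3, ?_⟩
  rw [map_pow, map_commutatorElement]
  rw [← comm_pow_left hK, ← comm_pow_left hK (ι r), ← comm_pow_left hK x']
  rw [← comm_pow_left hK] at h4 h5
  have h6 : ab (x ^ m) = ab (ι r ^ m * x' ^ m) := by
    rw [ex, ab_mul]; simp only [ab_pow, ab_mul, smul_add]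
  have h7 : ⁅ι r ^ m, y⁆ = ⁅ι r ^ m, ι r'⁆ := by
    rw [ey, comm_mul_right hK (ι r') y', h5, mul_one]
  have h8 : ⁅x' ^ m, y⁆ = ⁅x' ^ m, y'⁆ := by
    rw [ey, comm_mul_right hK (ι r') y', h4, one_mul]
  rw [comm_congr hK h6 rfl, comm_mul_left hK, h7, h8]

theorem split_pi (π : Set ℕ) (q : ℕ) (hq : 0 < q) : ∃ m n : ℕ, q = m * n ∧ m.Coprime n ∧
    (∀ p, p.Prime → p ∣ m → p ∈ π) ∧ (∀ p, p.Prime → p ∣ n → p ∉ π) := by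
  classical
  induction q using Nat.recOnPosPrimePosCoprime with
  | zero => omega
  | one => exact ⟨1, 1, by simp, by simp, fun p hp h => absurd (Nat.dvd_one.1 h) hp.ne_one,
      fun p hp h => absurd (Nat.dvd_one.1 h) hp.ne_one⟩
  | prime_pow p k hp hk =>
    have h1 : ∀ r, r.Prime → r ∣ p ^ k → r = p := fun r hr h =>
      (Nat.prime_dvd_prime_iff_eq hr hp).1 (hr.dvd_of_dvd_pow h)
    by_cases h : p ∈ π
    · exact ⟨p ^ k, 1, by simp, by simp, fun r hr e => h1 r hr e ▸ h,
        fun p hp h => absurd (Nat.dvd_one.1 h) hp.ne_one⟩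
    · exact ⟨1, p ^ k, by simp, by simp, fun p hp h => absurd (Nat.dvd_one.1 h) hp.ne_one,
        fun r hr e => h1 r hr e ▸ h⟩
  | coprime a b ha hb hab iha ihb =>
    obtain ⟨m, n, rfl, -, h2, h3⟩ := iha (by omega)
    obtain ⟨m', n', rfl, -, h2', h3'⟩ := ihb (by omega)
    have p1 : ∀ p, p.Prime → p ∣ m * m' → p ∈ π := fun p hp h =>
      (hp.dvd_mul.1 h).elim (h2 p hp) (h2' p hp)
    have p2 : ∀ p, p.Prime → p ∣ n * n' → p ∉ π := fun p hp h =>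
      (hp.dvd_mul.1 h).elim (h3 p hp) (h3' p hp)
    refine ⟨m * m', n * n', by ring, ?_, p1, p2⟩
    exact Nat.Coprime.symm (Nat.coprime_of_dvd fun p hp h h' => p2 p hp h (p1 p hp h'))

theorem roots {A : Type*} [Group A] (P : ℕ → Prop)
    (h : ∀ (a : A) (p : ℕ), p.Prime → P p → ∃ r : A, r ^ p = a) (m : ℕ) (hm : 0 < m)
    (hP : ∀ p, p.Prime → p ∣ m → P p) : ∀ a : A, ∃ r, r ^ m = a := by
  induction m using Nat.recOnMul with
  | zero => omega
  | one => exact fun a => ⟨a, pow_one a⟩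
  | prime p hp => exact fun a => h a p hp (hP p hp dvd_rfl)
  | mul a b iha ihb =>
    intro x
    obtain ⟨r, rfl⟩ := iha (Nat.pos_of_mul_pos_right hm) (fun p hp e => hP p hp (e.mul_right b)) x
    obtain ⟨s, rfl⟩ := ihb (Nat.pos_of_mul_pos_left hm) (fun p hp e => hP p hp (e.mul_left a)) r
    exact ⟨s, by rw [mul_comm, pow_mul]⟩

end Nil2

open Nil2 in
/-- If `A` is `π`-divisible and `B` is `π'`-divisible (both nil-2), then `A × B` is
absolutely closed in `N₂` iff both `A` and `B` are. -/
theorem prod_absolutelyClosed_iff_of_pi_divisible {A B : Type u} [Group A] [Group B]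
    (hA : IsNil2 A) (hB : IsNil2 B) (π : Set ℕ) (hπ : ∀ p ∈ π, Nat.Prime p)
    (hAdiv : ∀ (a : A) (p : ℕ), p.Prime → p ∈ π → ∃ r : A, r ^ p = a)
    (hBdiv : ∀ (b : B) (q : ℕ), q.Prime → q ∉ π → ∃ s : B, s ^ q = b) :
    IsAbsolutelyClosed (A × B) ↔ IsAbsolutelyClosed A ∧ IsAbsolutelyClosed B := by
  have hprod : ∀ (X Y : Type u) [Group X] [Group Y], IsNil2 X → IsNil2 Y → IsNil2 (X × Y) := by
    intro X Y _ _ hX hY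
    apply isNil2_of
    intro x y
    rw [Subgroup.mem_center_iff]
    intro g
    exact Prod.ext (Subgroup.mem_center_iff.1 (comm_center hX x.1 y.1) g.1)
      (Subgroup.mem_center_iff.1 (comm_center hY x.2 y.2) g.2)
  have hsub : ∀ {K : Type u} [Group K] (H : Subgroup K), (H : Set K) ⊆ Dominion H :=
    fun H h hh C _ _ f g e => e h hh
  constructor
  · intro hAB
    constructor
    · intro K _ hK ι hι
      refine Set.Subset.antisymm (fun d hd => ?_) (hsub _)
      have h := hAB (K × B) (hprod _ _ hK hB) (ι.prodMap (MonoidHom.id B))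
        (Function.Injective.prodMap hι Function.injective_id)
      have h1 : (d, (1 : B)) ∈ Dominion (ι.prodMap (MonoidHom.id B)).range := by
        intro C _ hC f g e
        refine hd C hC (f.comp (MonoidHom.inl K B)) (g.comp (MonoidHom.inl K B)) ?_
        rintro _ ⟨a, rfl⟩
        exact e _ ⟨(a, 1), rfl⟩
      rw [h] at h1
      obtain ⟨⟨a, b⟩, hab⟩ := h1
      exact ⟨a, congrArg Prod.fst hab⟩
    · intro K _ hK ι hι
      refine Set.Subset.antisymm (fun d hd => ?_) (hsub _)
      have h := hAB (A × K) (hprod _ _ hA hK) ((MonoidHom.id A).prodMap ι)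
        (Function.Injective.prodMap Function.injective_id hι)
      have h1 : ((1 : A), d) ∈ Dominion ((MonoidHom.id A).prodMap ι).range := by
        intro C _ hC f g e
        refine hd C hC (f.comp (MonoidHom.inr A K)) (g.comp (MonoidHom.inr A K)) ?_
        rintro _ ⟨a, rfl⟩
        exact e _ ⟨(1, a), rfl⟩
      rw [h] at h1
      obtain ⟨⟨a, b⟩, hab⟩ := h1
      exact ⟨b, congrArg Prod.snd hab⟩
  · rintro ⟨hAc, hBc⟩ K _ hK ι hι
    refine Set.Subset.antisymm (fun d hd => ?_) (hsub _)
    have hdom := dominion_le hK _ d hd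
    suffices hgen : gens ι.range ⊆ ι.range by
      exact (sup_le le_rfl ((Subgroup.closure_le _).2 hgen)) hdom
    let ιA : A →* K := ι.comp (MonoidHom.inl A B)
    let ιB : B →* K := ι.comp (MonoidHom.inr A B)
    have hιA : Function.Injective ιA := hι.comp (fun a b e => congrArg Prod.fst e)
    have hιB : Function.Injective ιB := hι.comp (fun a b e => congrArg Prod.snd e)
    have hAB : ∀ a b, ιA a * ιB b = ι (a, b) := fun a b => by
      simp [ιA, ιB, ← map_mul]
    have hBA : ∀ a b, ιB b * ιA a = ι (a, b) := fun a b => by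
      simp [ιA, ιB, ← map_mul]
    have dA := hAc K hK ιA hιA
    have dB := hBc K hK ιB hιB
    have typeA : ∀ (m : ℕ) (x y : K), (∀ a : A, ∃ r, r ^ m = a) →
        (∃ h ∈ ι.range, ab h = m • ab x) → (∃ h ∈ ι.range, ab h = m • ab y) →
        ⁅x, y⁆ ^ m ∈ ι.range := by
      rintro m x y hr ⟨_, ⟨⟨a, b⟩, rfl⟩, hx⟩ ⟨_, ⟨⟨a', b'⟩, rfl⟩, hy⟩
      obtain ⟨a, _, ⟨b, rfl⟩, e⟩ := half hK ιB.range ιA dB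
        (by rintro a _ ⟨b, rfl⟩; rw [hAB, hBA]) m hr x y
        ⟨a, _, ⟨b, rfl⟩, by rw [hAB, hx]⟩ ⟨a', _, ⟨b', rfl⟩, by rw [hAB, hy]⟩
      exact ⟨(a, b), by rw [e, hAB]⟩
    have typeB : ∀ (m : ℕ) (x y : K), (∀ a : B, ∃ r, r ^ m = a) →
        (∃ h ∈ ι.range, ab h = m • ab x) → (∃ h ∈ ι.range, ab h = m • ab y) →
        ⁅x, y⁆ ^ m ∈ ι.range := by
      rintro m x y hr ⟨_, ⟨⟨a, b⟩, rfl⟩, hx⟩ ⟨_, ⟨⟨a', b'⟩, rfl⟩, hy⟩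
      obtain ⟨b, _, ⟨a, rfl⟩, e⟩ := half hK ιA.range ιB dA
        (by rintro a _ ⟨b, rfl⟩; rw [hAB, hBA]) m hr x y
        ⟨b, _, ⟨a, rfl⟩, by rw [hBA, hx]⟩ ⟨b', _, ⟨a', rfl⟩, by rw [hBA, hy]⟩
      exact ⟨(a, b), by rw [e, hBA]⟩
    rintro _ ⟨q, x, y, hq, hx, hy, rfl⟩
    obtain ⟨m, n, rfl, hco, hm, hn⟩ := split_pi π q hq
    have hm0 : 0 < m := Nat.pos_of_mul_pos_right hq
    have hn0 : 0 < n := Nat.pos_of_mul_pos_left hq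
    have rA := roots (· ∈ π) hAdiv m hm0 hm
    have rB := roots (· ∉ π) hBdiv n hn0 hn
    have h1 : ⁅x, y⁆ ^ (m * n * n) ∈ ι.range := by
      have := typeA m (x ^ n) (y ^ n) rA (by rw [ab_pow, smul_smul]; exact hx)
        (by rw [ab_pow, smul_smul]; exact hy)
      rw [comm_pow_left hK, comm_pow_right hK, ← pow_mul, ← pow_mul] at this
      rwa [show m * n * n = n * (n * m) by ring]
    have h2 : ⁅x, y⁆ ^ (m * n * m) ∈ ι.range := by
      have := typeB n (x ^ m) (y ^ m) rB (by rw [ab_pow, smul_smul, mul_comm]; exact hx)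
        (by rw [ab_pow, smul_smul, mul_comm]; exact hy)
      rw [comm_pow_left hK, comm_pow_right hK, ← pow_mul, ← pow_mul] at this
      rwa [show m * n * m = m * (m * n) by ring]
    have hb := Nat.gcd_eq_gcd_ab m n
    rw [hco.gcd_eq_one] at hb
    rw [pow_mul] at h1 h2
    have h3 := ι.range.mul_mem (ι.range.zpow_mem h2 (m.gcdA n)) (ι.range.zpow_mem h1 (m.gcdB n))
    rw [← zpow_natCast _ m, ← zpow_natCast _ n, ← zpow_mul, ← zpow_mul, ← zpow_add, ← hb] at h3
    simpa using h3
end
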